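/- arXiv:2101.00624 — 12 statements merged into one kernel-verified Lean document; each statement's English description precedes it below -/
import Mathlib

section
/- Let ν and ν* be nonnegative Borel measures on ℝ^d with ν* ≤ ν, ν({0}) = 0 and ∫_{ℝ^d} (1 ∧ |u|²) ν(du) < ∞. Then for every x ∈ ℝ^d with x ≠ 0, the measure ν*_x := ν* ⊓ (δ_x * ν*) satisfies ν*_x(ℝ^d) ≤ 8 (1 ∧ |x|)^{-2} ∫_{ℝ^d} (1 ∧ |u|²) ν(du) < ∞; in particular, ν*_x is a finite measure. -/
open MeasureTheory Set
open scoped ENNReal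

/-- Since `u` and `u - x` cannot both be shorter than `‖x‖ / 2`, the truncated squares of their
norms are together at least `(1 ∧ ‖x‖)² / 4`. -/
lemma one_le_mul_min_one_sq_norm_add {E : Type*} [NormedAddCommGroup E] {x : E} (hx : x ≠ 0)
    (u : E) :
    1 ≤ 4 * (min 1 ‖x‖)⁻¹ ^ 2 * (min 1 (‖u‖ ^ 2) + min 1 (‖u - x‖ ^ 2)) := by
  have hm : 0 < min 1 ‖x‖ := lt_min one_pos (norm_pos_iff.mpr hx)
  have of_half_le (t : ℝ) (ht : ‖x‖ / 2 ≤ t) : (min 1 ‖x‖) ^ 2 / 4 ≤ min 1 (t ^ 2) := by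
    have h1 : min 1 ‖x‖ ≤ 1 := min_le_left _ _
    have h2 : min 1 ‖x‖ ≤ ‖x‖ := min_le_right _ _
    apply le_min <;> nlinarith
  have htri : ‖x‖ ≤ ‖u‖ + ‖u - x‖ := by
    simpa using norm_sub_le u (u - x)
  have hsum : (min 1 ‖x‖) ^ 2 / 4 ≤ min 1 (‖u‖ ^ 2) + min 1 (‖u - x‖ ^ 2) := by
    have hu : 0 ≤ min 1 (‖u‖ ^ 2) := by positivity
    have hux : 0 ≤ min 1 (‖u - x‖ ^ 2) := by positivity
    rcases le_total (‖x‖ / 2) ‖u‖ with h | h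
    · linarith [of_half_le _ h]
    · linarith [of_half_le ‖u - x‖ (by linarith)]
  calc (1 : ℝ) = 4 * (min 1 ‖x‖)⁻¹ ^ 2 * ((min 1 ‖x‖) ^ 2 / 4) := by field_simp
    _ ≤ _ := by gcongr

/-- For nonnegative Borel measures `ν* ≤ ν` on `ℝ^d` with `ν({0}) = 0` and
`∫ (1 ∧ |u|²) ν(du) < ∞`, for every `x ≠ 0` the measure `ν*_x := ν* ⊓ (δ_x * ν*)` satisfies
`ν*_x(ℝ^d) ≤ 8 (1 ∧ |x|)⁻² ∫ (1 ∧ |u|²) ν(du) < ∞`; in particular `ν*_x` is finite. -/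
theorem stmt0 (d : ℕ) (ν νstar : Measure (EuclideanSpace ℝ (Fin d)))
    (hle : νstar ≤ ν) (hν0 : ν {0} = 0)
    (hν : ∫⁻ u, ENNReal.ofReal (min 1 (‖u‖ ^ 2)) ∂ν < ∞)
    (x : EuclideanSpace ℝ (Fin d)) (hx : x ≠ 0) :
    (νstar ⊓ Measure.map (fun u => u + x) νstar) Set.univ ≤
        ENNReal.ofReal (8 * (min 1 ‖x‖)⁻¹ ^ 2) * ∫⁻ u, ENNReal.ofReal (min 1 (‖u‖ ^ 2)) ∂ν ∧
      (νstar ⊓ Measure.map (fun u => u + x) νstar) Set.univ < ∞ := by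
  suffices hbound : (νstar ⊓ Measure.map (fun u => u + x) νstar) Set.univ ≤
      ENNReal.ofReal (8 * (min 1 ‖x‖)⁻¹ ^ 2) * ∫⁻ u, ENNReal.ofReal (min 1 (‖u‖ ^ 2)) ∂ν from
    ⟨hbound, hbound.trans_lt (ENNReal.mul_lt_top ENNReal.ofReal_lt_top hν)⟩
  set ρ := νstar ⊓ Measure.map (fun u => u + x) νstar
  set c : ℝ := 4 * (min 1 ‖x‖)⁻¹ ^ 2 with hc
  have hc0 : 0 ≤ c := by positivity
  set f : EuclideanSpace ℝ (Fin d) → ℝ≥0∞ := fun u => ENNReal.ofReal (min 1 (‖u‖ ^ 2)) with hf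
  have hfm : Measurable f := by fun_prop
  have hpoint (u : EuclideanSpace ℝ (Fin d)) : 1 ≤ ENNReal.ofReal c * (f u + f (u - x)) := by
    rw [hf, ← ENNReal.ofReal_add (by positivity) (by positivity), ← ENNReal.ofReal_mul hc0,
      ENNReal.one_le_ofReal]
    exact one_le_mul_min_one_sq_norm_add hx u
  have hunshifted : ∫⁻ u, f u ∂ρ ≤ ∫⁻ u, f u ∂ν :=
    lintegral_mono' (inf_le_left.trans hle) le_rfl
  have hshifted : ∫⁻ u, f (u - x) ∂ρ ≤ ∫⁻ u, f u ∂ν := calc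
    ∫⁻ u, f (u - x) ∂ρ ≤ ∫⁻ u, f (u - x) ∂(Measure.map (fun u => u + x) νstar) :=
      lintegral_mono' inf_le_right le_rfl
    _ = ∫⁻ u, f u ∂νstar := by
      rw [lintegral_map (by fun_prop) (by fun_prop)]
      simp only [add_sub_cancel_right]
    _ ≤ ∫⁻ u, f u ∂ν := lintegral_mono' hle le_rfl
  calc ρ Set.univ = ∫⁻ _, 1 ∂ρ := lintegral_one.symm
    _ ≤ ∫⁻ u, ENNReal.ofReal c * (f u + f (u - x)) ∂ρ := lintegral_mono hpoint
    _ = ENNReal.ofReal c * (∫⁻ u, f u ∂ρ + ∫⁻ u, f (u - x) ∂ρ) := by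
      rw [lintegral_const_mul _ (by fun_prop), lintegral_add_left hfm]
    _ ≤ ENNReal.ofReal c * (∫⁻ u, f u ∂ν + ∫⁻ u, f u ∂ν) := by gcongr
    _ = ENNReal.ofReal (8 * (min 1 ‖x‖)⁻¹ ^ 2) * ∫⁻ u, f u ∂ν := by
      rw [show 8 * (min 1 ‖x‖)⁻¹ ^ 2 = c + c by rw [hc]; ring, ENNReal.ofReal_add hc0 hc0]
      ring
end

section
/- Fix α, κ > 0 and q ∈ ℝ^d. Let ν be a nonnegative Borel measure on ℝ^d with ν({0}) = 0 and ∫_{ℝ^d}(1 ∧ |u|²) ν(du) < ∞, and let ν* ≤ ν be a nonnegative measure; for y ∈ ℝ^d set ν*_y := ν* ⊓ (δ_y * ν*). Then for all bounded C² functions g, h : ℝ^d → ℝ with bounded first and second derivatives, the function f(v,v') := g(v) + h(v') satisfies (𝓛̃_{q} f)(v,v') = (𝓛_0 g)(v) + (𝓛_0 h)(v') for all v, v' ∈ ℝ^d, where 𝓛_0 and 𝓛̃_{q} are the operators defined in the context. -/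
open MeasureTheory Set
open scoped ENNReal RealInnerProductSpace

noncomputable section

/-- The truncation `(x)_κ := (1 ∧ κ/|x|) x` (with `(0)_κ = 0`). -/
def trunc {d : ℕ} (κ : ℝ) (x : EuclideanSpace ℝ (Fin d)) : EuclideanSpace ℝ (Fin d) :=
  (min 1 (κ / ‖x‖)) • x

/-- The measure `ν*_y := ν* ⊓ (δ_y * ν*)`. -/
def nuInf {d : ℕ} (νstar : Measure (EuclideanSpace ℝ (Fin d))) (y : EuclideanSpace ℝ (Fin d)) :
    Measure (EuclideanSpace ℝ (Fin d)) :=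
  νstar ⊓ Measure.map (fun u => u + y) νstar

/-- The generator of the pure-jump Lévy process:
`(𝓛₀ g)(x) = ∫ (g(x+u) − g(x) − ⟨∇g(x),u⟩ 1_{|u|≤1}) ν(du)`. -/
def levyGen {d : ℕ} (ν : Measure (EuclideanSpace ℝ (Fin d)))
    (g : EuclideanSpace ℝ (Fin d) → ℝ) (x : EuclideanSpace ℝ (Fin d)) : ℝ :=
  ∫ u, (g (x + u) - g x - (if ‖u‖ ≤ 1 then fderiv ℝ g x u else 0)) ∂ν

/-- Integrand of the first (jump `+α(q)_κ`) part of the refined basic coupling operator. -/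
def jumpP {d : ℕ} (α κ : ℝ) (q : EuclideanSpace ℝ (Fin d))
    (F : EuclideanSpace ℝ (Fin d) → EuclideanSpace ℝ (Fin d) → ℝ)
    (v v' u : EuclideanSpace ℝ (Fin d)) : ℝ :=
  F (v + u) (v' + u + α • trunc κ q) - F v v'
    - (if ‖u‖ ≤ 1 then fderiv ℝ (fun w => F w v') v u else 0)
    - (if ‖u + α • trunc κ q‖ ≤ 1 then fderiv ℝ (fun w => F v w) v' (u + α • trunc κ q) else 0)

/-- Integrand of the second (jump `−α(q)_κ`) part of the refined basic coupling operator. -/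
def jumpM {d : ℕ} (α κ : ℝ) (q : EuclideanSpace ℝ (Fin d))
    (F : EuclideanSpace ℝ (Fin d) → EuclideanSpace ℝ (Fin d) → ℝ)
    (v v' u : EuclideanSpace ℝ (Fin d)) : ℝ :=
  F (v + u) (v' + u - α • trunc κ q) - F v v'
    - (if ‖u‖ ≤ 1 then fderiv ℝ (fun w => F w v') v u else 0)
    - (if ‖u - α • trunc κ q‖ ≤ 1 then fderiv ℝ (fun w => F v w) v' (u - α • trunc κ q) else 0)

/-- Integrand of the synchronous part of the refined basic coupling operator. -/
def jumpS {d : ℕ}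
    (F : EuclideanSpace ℝ (Fin d) → EuclideanSpace ℝ (Fin d) → ℝ)
    (v v' u : EuclideanSpace ℝ (Fin d)) : ℝ :=
  F (v + u) (v' + u) - F v v'
    - (if ‖u‖ ≤ 1 then fderiv ℝ (fun w => F w v') v u else 0)
    - (if ‖u‖ ≤ 1 then fderiv ℝ (fun w => F v w) v' u else 0)

/-- The jump (refined basic coupling) operator `𝓛̃_q` acting on `F(v,v')`. -/
def couplingJump {d : ℕ} (ν νstar : Measure (EuclideanSpace ℝ (Fin d))) (α κ : ℝ)
    (q : EuclideanSpace ℝ (Fin d))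
    (F : EuclideanSpace ℝ (Fin d) → EuclideanSpace ℝ (Fin d) → ℝ)
    (v v' : EuclideanSpace ℝ (Fin d)) : ℝ :=
  (1 / 2) * (∫ u, jumpP α κ q F v v' u ∂(nuInf νstar (-(α • trunc κ q))))
    + (1 / 2) * (∫ u, jumpM α κ q F v v' u ∂(nuInf νstar (α • trunc κ q)))
    + ∫ u, jumpS F v v' u
        ∂(ν - (1 / 2 : ℝ≥0∞) • nuInf νstar (-(α • trunc κ q))
            - (1 / 2 : ℝ≥0∞) • nuInf νstar (α • trunc κ q))

/-- The full coupling operator `𝓛̃ = 𝓛̃₁ + 𝓛̃_{x,x'}` acting on `F((x,v),(x',v'))`. -/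
def couplingOp {d : ℕ} (ν νstar : Measure (EuclideanSpace ℝ (Fin d))) (a b α κ : ℝ)
    (U : EuclideanSpace ℝ (Fin d) × EuclideanSpace ℝ (Fin d) → EuclideanSpace ℝ (Fin d))
    (F : EuclideanSpace ℝ (Fin d) → EuclideanSpace ℝ (Fin d) → EuclideanSpace ℝ (Fin d) →
      EuclideanSpace ℝ (Fin d) → ℝ)
    (x v x' v' : EuclideanSpace ℝ (Fin d)) : ℝ :=
  fderiv ℝ (fun y => F y v x' v') x (a • x + b • v)
    + fderiv ℝ (fun y => F x v y v') x' (a • x' + b • v')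
    + fderiv ℝ (fun w => F x w x' v') v (U (x, v))
    + fderiv ℝ (fun w => F x v x' w) v' (U (x', v'))
    + couplingJump ν νstar α κ ((x - x') + α⁻¹ • (v - v')) (fun w w' => F x w x' w') v v'

/-- Integrability of all three integrals defining the jump coupling operator. -/
def JumpIntegrable {d : ℕ} (ν νstar : Measure (EuclideanSpace ℝ (Fin d))) (α κ : ℝ)
    (q : EuclideanSpace ℝ (Fin d))
    (F : EuclideanSpace ℝ (Fin d) → EuclideanSpace ℝ (Fin d) → ℝ)
    (v v' : EuclideanSpace ℝ (Fin d)) : Prop :=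
  Integrable (jumpP α κ q F v v') (nuInf νstar (-(α • trunc κ q)))
    ∧ Integrable (jumpM α κ q F v v') (nuInf νstar (α • trunc κ q))
    ∧ Integrable (jumpS F v v')
        (ν - (1 / 2 : ℝ≥0∞) • nuInf νstar (-(α • trunc κ q))
          - (1 / 2 : ℝ≥0∞) • nuInf νstar (α • trunc κ q))

/-- The distance part of the cost function: `H((x,v),(x',v')) = f(α₀|x−x'| + |x−x'+α⁻¹(v−v')|)`. -/
def Hfun {d : ℕ} (f : ℝ → ℝ) (α α₀ : ℝ)
    (x v x' v' : EuclideanSpace ℝ (Fin d)) : ℝ :=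
  f (α₀ * ‖x - x'‖ + ‖(x - x') + α⁻¹ • (v - v')‖)

/-- The Lyapunov part of the cost function: `G((x,v),(x',v')) = 1 + ε(𝒲(x,v)+𝒲(x',v'))`. -/
def Gfun {d : ℕ} (W : EuclideanSpace ℝ (Fin d) → EuclideanSpace ℝ (Fin d) → ℝ) (ε : ℝ)
    (x v x' v' : EuclideanSpace ℝ (Fin d)) : ℝ :=
  1 + ε * (W x v + W x' v')

/-- The correction term `Π` in the product rule for the coupling operator. -/
def PiCorr {d : ℕ} (νstar : Measure (EuclideanSpace ℝ (Fin d))) (α κ : ℝ)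
    (q : EuclideanSpace ℝ (Fin d))
    (H G : EuclideanSpace ℝ (Fin d) → EuclideanSpace ℝ (Fin d) → ℝ)
    (v v' : EuclideanSpace ℝ (Fin d)) : ℝ :=
  (1 / 2) * ∫ u, (H (v + u) (v' + u + α • trunc κ q) - H v v')
      * (G (v + u) (v' + u + α • trunc κ q) - G v v') ∂(nuInf νstar (-(α • trunc κ q)))
    + (1 / 2) * ∫ u, (H (v + u) (v' + u - α • trunc κ q) - H v v')
      * (G (v + u) (v' + u - α • trunc κ q) - G v v') ∂(nuInf νstar (α • trunc κ q))


namespace MeasureTheory.Measure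

variable {X : Type*} [MeasurableSpace X] {μ a b : Measure X}

theorem sub_sub_add_cancel_of_finite [IsFiniteMeasure μ] (hab : a + b ≤ μ) :
    μ - a - b + (a + b) = μ := by
  have ha : a ≤ μ := (Measure.le_add_right le_rfl).trans hab
  have hb : b ≤ μ := (Measure.le_add_left le_rfl).trans hab
  have : IsFiniteMeasure a := isFiniteMeasure_of_le μ ha
  have : IsFiniteMeasure b := isFiniteMeasure_of_le μ hb
  have hle : b ≤ μ - a := by
    apply Measure.le_of_add_le_add_left (μ := a)
    rwa [add_comm a (μ - a), sub_add_cancel_of_le ha]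
  rw [add_comm a b, ← add_assoc, sub_add_cancel_of_le hle, sub_add_cancel_of_le ha]

theorem sub_sub_add_cancel [SigmaFinite μ] (hab : a + b ≤ μ) :
    μ - a - b + (a + b) = μ := by
  refine (ext_iff_of_iUnion_eq_univ (iUnion_spanningSets μ)).2 fun n => ?_
  have hn := measurableSet_spanningSets μ n
  have : IsFiniteMeasure (μ.restrict (spanningSets μ n)) :=
    isFiniteMeasure_restrict.2 (measure_spanningSets_lt_top μ n).ne
  rw [restrict_add, restrict_add, restrict_sub_eq_restrict_sub_restrict hn,
    restrict_sub_eq_restrict_sub_restrict hn]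
  apply sub_sub_add_cancel_of_finite
  rw [← restrict_add]
  exact restrict_mono_measure hab _

theorem sigmaFinite_of_lintegral_ne_top {w : X → ℝ≥0∞} (hw : Measurable w)
    (h0 : ∀ᵐ x ∂μ, w x ≠ 0) (htop : ∀ x, w x ≠ ∞) (hint : ∫⁻ x, w x ∂μ ≠ ∞) :
    SigmaFinite μ := by
  have : IsFiniteMeasure (μ.withDensity w) := isFiniteMeasure_withDensity hint
  rw [← withDensity_inv_same hw h0 (Filter.Eventually.of_forall htop)]
  refine SigmaFinite.withDensity_of_ne_top ?_
  filter_upwards [(withDensity_absolutelyContinuous μ w).ae_le h0] with x hx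
  simpa using hx

/-- Pushforward along a measurable equivalence commutes with infima of measures. -/
theorem map_inf_equiv {Y : Type*} [MeasurableSpace Y] (e : X ≃ᵐ Y) :
    (a ⊓ b).map e = a.map e ⊓ b.map e := by
  apply le_antisymm
  · exact le_inf (map_mono inf_le_left e.measurable) (map_mono inf_le_right e.measurable)
  · rw [← e.map_map_symm (ν := a.map e ⊓ b.map e)]
    refine map_mono (le_inf ?_ ?_) e.measurable
    · simpa using map_mono (inf_le_left : a.map e ⊓ b.map e ≤ _) e.symm.measurable
    · simpa using map_mono (inf_le_right : a.map e ⊓ b.map e ≤ _) e.symm.measurable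

end MeasureTheory.Measure

section

variable {d : ℕ}

/-- Integrand of the Lévy generator. -/
def levyIntegrand (g : EuclideanSpace ℝ (Fin d) → ℝ) (x u : EuclideanSpace ℝ (Fin d)) : ℝ :=
  g (x + u) - g x - (if ‖u‖ ≤ 1 then fderiv ℝ g x u else 0)

theorem nuInf_le (μ : Measure (EuclideanSpace ℝ (Fin d))) (y : EuclideanSpace ℝ (Fin d)) :
    nuInf μ y ≤ μ :=
  inf_le_left

theorem map_nuInf_neg (μ : Measure (EuclideanSpace ℝ (Fin d))) (y : EuclideanSpace ℝ (Fin d)) :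
    (nuInf μ (-y)).map (MeasurableEquiv.addRight y) = nuInf μ y := by
  rw [nuInf, nuInf, Measure.map_inf_equiv, inf_comm, MeasurableEquiv.coe_addRight,
    Measure.map_map (by fun_prop) (by fun_prop)]
  simp [Function.comp_def]

theorem levyIntegrand_bound {g : EuclideanSpace ℝ (Fin d) → ℝ} (hg : ContDiff ℝ 2 g)
    (hgb : ∃ C, ∀ x, |g x| ≤ C) (hgb2 : ∃ C, ∀ x, ‖fderiv ℝ (fderiv ℝ g) x‖ ≤ C)
    (x : EuclideanSpace ℝ (Fin d)) :
    ∃ C, ∀ u, ‖levyIntegrand g x u‖ ≤ C * min 1 (‖u‖ ^ 2) := by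
  obtain ⟨A, hA⟩ := hgb
  obtain ⟨B, hB⟩ := hgb2
  have hA0 : 0 ≤ A := (abs_nonneg _).trans (hA x)
  have hB0 : 0 ≤ B := (norm_nonneg (fderiv ℝ (fderiv ℝ g) x)).trans (hB x)
  refine ⟨2 * A + B, fun u => ?_⟩
  unfold levyIntegrand
  split_ifs with hu
  · have hsq : ‖u‖ ^ 2 ≤ 1 := pow_le_one₀ (norm_nonneg _) hu
    rw [min_eq_right hsq]
    have hderiv : ∀ z ∈ segment ℝ x (x + u), ‖fderiv ℝ g z - fderiv ℝ g x‖ ≤ B * ‖u‖ := by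
      intro z hz
      have hdd : Differentiable ℝ (fderiv ℝ g) :=
        (hg.fderiv_right (m := 1) (by norm_num)).differentiable (by norm_num)
      refine (convex_univ.norm_image_sub_le_of_norm_fderiv_le (𝕜 := ℝ) (fun y _ => hdd y)
        (fun y _ => hB y) (mem_univ x) (mem_univ z)).trans ?_
      gcongr
      simpa using norm_sub_le_of_mem_segment hz
    have htaylor := (convex_segment x (x + u)).norm_image_sub_le_of_norm_fderiv_le' (𝕜 := ℝ)
      (fun z _ => (hg.differentiable (by norm_num)) z) hderiv
      (left_mem_segment ℝ x (x + u)) (right_mem_segment ℝ x (x + u))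
    rw [add_sub_cancel_left] at htaylor
    nlinarith [sq_nonneg ‖u‖]
  · have hsq : 1 ≤ ‖u‖ ^ 2 := one_le_pow₀ (not_le.1 hu).le
    rw [min_eq_left hsq, sub_zero, Real.norm_eq_abs]
    linarith [abs_sub (g (x + u)) (g x), hA x, hA (x + u)]

theorem integrable_levyIntegrand {ν : Measure (EuclideanSpace ℝ (Fin d))}
    (hν : ∫⁻ u, ENNReal.ofReal (min 1 (‖u‖ ^ 2)) ∂ν < ∞)
    {g : EuclideanSpace ℝ (Fin d) → ℝ} (hg : ContDiff ℝ 2 g)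
    (hgb : ∃ C, ∀ x, |g x| ≤ C) (hgb2 : ∃ C, ∀ x, ‖fderiv ℝ (fderiv ℝ g) x‖ ≤ C)
    (x : EuclideanSpace ℝ (Fin d)) : Integrable (levyIntegrand g x) ν := by
  obtain ⟨C, hC⟩ := levyIntegrand_bound hg hgb hgb2 x
  have hmin : Integrable (fun u : EuclideanSpace ℝ (Fin d) => min 1 (‖u‖ ^ 2)) ν := by
    refine ⟨by fun_prop, ?_⟩
    rw [hasFiniteIntegral_iff_ofReal (Filter.Eventually.of_forall fun u => by positivity)]
    exact hν
  refine (hmin.const_mul C).mono' ?_ (Filter.Eventually.of_forall hC)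
  have hgc := hg.continuous
  refine Measurable.aestronglyMeasurable ?_
  refine Measurable.sub (by fun_prop) (Measurable.ite ?_ (by fun_prop) (by fun_prop))
  exact measurableSet_le (by fun_prop) (by fun_prop)

theorem jumpP_add (α κ : ℝ) (q : EuclideanSpace ℝ (Fin d))
    (g h : EuclideanSpace ℝ (Fin d) → ℝ) (v v' u : EuclideanSpace ℝ (Fin d)) :
    jumpP α κ q (fun w w' => g w + h w') v v' u =
      levyIntegrand g v u + levyIntegrand h v' (u + α • trunc κ q) := by
  simp only [jumpP, levyIntegrand, fderiv_add_const, fderiv_const_add, add_assoc]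
  ring

theorem jumpM_add (α κ : ℝ) (q : EuclideanSpace ℝ (Fin d))
    (g h : EuclideanSpace ℝ (Fin d) → ℝ) (v v' u : EuclideanSpace ℝ (Fin d)) :
    jumpM α κ q (fun w w' => g w + h w') v v' u =
      levyIntegrand g v u + levyIntegrand h v' (u + -(α • trunc κ q)) := by
  simp only [jumpM, levyIntegrand, fderiv_add_const, fderiv_const_add, sub_eq_add_neg, add_assoc]
  ring

theorem jumpS_add (g h : EuclideanSpace ℝ (Fin d) → ℝ) (v v' u : EuclideanSpace ℝ (Fin d)) :
    jumpS (fun w w' => g w + h w') v v' u = levyIntegrand g v u + levyIntegrand h v' u := by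
  simp only [jumpS, levyIntegrand, fderiv_add_const, fderiv_const_add]
  ring

/-- Shifting the second marginal by `y` turns `ν*_{-y}` into `ν*_y`. -/
theorem integral_add_shift_nuInf {μ : Measure (EuclideanSpace ℝ (Fin d))}
    {G H : EuclideanSpace ℝ (Fin d) → ℝ} (hG : Integrable G μ) (hH : Integrable H μ)
    (y : EuclideanSpace ℝ (Fin d)) :
    ∫ u, (G u + H (u + y)) ∂(nuInf μ (-y)) =
      (∫ u, G u ∂(nuInf μ (-y))) + ∫ u, H u ∂(nuInf μ y) := by
  have hHy : Integrable (fun u => H (u + y)) (nuInf μ (-y)) := by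
    have := hH.mono_measure (nuInf_le μ y)
    rw [← map_nuInf_neg μ y] at this
    exact (integrable_map_equiv (MeasurableEquiv.addRight y) H).1 this
  rw [integral_add (hG.mono_measure (nuInf_le μ _)) hHy, ← map_nuInf_neg μ y,
    integral_map_equiv]
  rfl

theorem half_smul_nuInf_add_le (μ : Measure (EuclideanSpace ℝ (Fin d)))
    (y z : EuclideanSpace ℝ (Fin d)) :
    (1 / 2 : ℝ≥0∞) • nuInf μ y + (1 / 2 : ℝ≥0∞) • nuInf μ z ≤ μ := by
  intro s
  calc ((1 / 2 : ℝ≥0∞) • nuInf μ y + (1 / 2 : ℝ≥0∞) • nuInf μ z) s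
      = (1 / 2) * nuInf μ y s + (1 / 2) * nuInf μ z s := by simp
    _ ≤ (1 / 2) * μ s + (1 / 2) * μ s := by
        gcongr
        · exact nuInf_le μ y
        · exact nuInf_le μ z
    _ = μ s := by rw [← add_mul, ENNReal.add_halves, one_mul]

theorem sigmaFinite_of_levy {ν : Measure (EuclideanSpace ℝ (Fin d))} (hν0 : ν {0} = 0)
    (hν : ∫⁻ u, ENNReal.ofReal (min 1 (‖u‖ ^ 2)) ∂ν < ∞) : SigmaFinite ν := by
  refine Measure.sigmaFinite_of_lintegral_ne_top (by fun_prop) ?_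
    (fun _ => ENNReal.ofReal_ne_top) hν.ne
  have h0 : ∀ᵐ u ∂ν, u ≠ 0 := by
    rw [ae_iff]
    simpa using hν0
  filter_upwards [h0] with u hu
  rw [Ne, ENNReal.ofReal_eq_zero, not_le]
  have := norm_pos_iff.2 hu
  positivity

end

/-- the refined basic coupling operator `𝓛̃_q` is a coupling operator of the
Lévy generator `𝓛₀`: for bounded `C²` functions `g, h` with bounded first and second
derivatives, `(𝓛̃_q (g ⊕ h))(v,v') = (𝓛₀ g)(v) + (𝓛₀ h)(v')`. -/
theorem stmt2 (d : ℕ) (α κ : ℝ) (hα : 0 < α) (hκ : 0 < κ)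
    (q : EuclideanSpace ℝ (Fin d))
    (ν νstar : Measure (EuclideanSpace ℝ (Fin d)))
    (hν0 : ν {0} = 0)
    (hν : ∫⁻ u, ENNReal.ofReal (min 1 (‖u‖ ^ 2)) ∂ν < ∞)
    (hle : νstar ≤ ν)
    (g h : EuclideanSpace ℝ (Fin d) → ℝ)
    (hg : ContDiff ℝ 2 g) (hh : ContDiff ℝ 2 h)
    (hgb : ∃ C, ∀ x, |g x| ≤ C) (hhb : ∃ C, ∀ x, |h x| ≤ C)
    (hgb1 : ∃ C, ∀ x, ‖fderiv ℝ g x‖ ≤ C) (hhb1 : ∃ C, ∀ x, ‖fderiv ℝ h x‖ ≤ C)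
    (hgb2 : ∃ C, ∀ x, ‖fderiv ℝ (fderiv ℝ g) x‖ ≤ C)
    (hhb2 : ∃ C, ∀ x, ‖fderiv ℝ (fderiv ℝ h) x‖ ≤ C) :
    ∀ v v' : EuclideanSpace ℝ (Fin d),
      couplingJump ν νstar α κ q (fun w w' => g w + h w') v v' =
        levyGen ν g v + levyGen ν h v' := by
  intro v v'
  set y := α • trunc κ q with hy
  have := sigmaFinite_of_levy hν0 hν
  have hG := integrable_levyIntegrand hν hg hgb hgb2 v
  have hH := integrable_levyIntegrand hν hh hhb hhb2 v'
  have hGH : Integrable (fun u => levyIntegrand g v u + levyIntegrand h v' u) ν := hG.add hH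
  have hsum := Measure.sub_sub_add_cancel
    ((half_smul_nuInf_add_le νstar (-y) y).trans hle)
  have hP := integral_add_shift_nuInf (hG.mono_measure hle) (hH.mono_measure hle) y
  have hM := integral_add_shift_nuInf (hG.mono_measure hle) (hH.mono_measure hle) (-y)
  rw [neg_neg] at hM
  have hint : ∀ z, Integrable (levyIntegrand g v) (nuInf νstar z) ∧
      Integrable (levyIntegrand h v') (nuInf νstar z) := fun z =>
    ⟨hG.mono_measure ((nuInf_le _ _).trans hle), hH.mono_measure ((nuInf_le _ _).trans hle)⟩
  have htotal : levyGen ν g v + levyGen ν h v' =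
      ∫ u, (levyIntegrand g v u + levyIntegrand h v' u) ∂ν := (integral_add hG hH).symm
  have hhalf : ∀ z, Integrable (fun u => levyIntegrand g v u + levyIntegrand h v' u)
      ((1 / 2 : ℝ≥0∞) • nuInf νstar z) := fun z =>
    ((hint z).1.add (hint z).2).smul_measure (by norm_num)
  have hrest := hGH.mono_measure (Measure.sub_le.trans Measure.sub_le :
    ν - (1 / 2 : ℝ≥0∞) • nuInf νstar (-y) - (1 / 2 : ℝ≥0∞) • nuInf νstar y ≤ ν)
  simp only [couplingJump, jumpP_add, jumpM_add, jumpS_add, ← hy]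
  rw [htotal]
  conv_rhs => rw [← hsum]
  rw [integral_add_measure hrest ((hhalf _).add_measure (hhalf _)),
    integral_add_measure (hhalf _) (hhalf _), integral_smul_measure, integral_smul_measure,
    integral_add (hint _).1 (hint _).2, integral_add (hint _).1 (hint _).2, hP, hM]
  simp only [one_div, ENNReal.toReal_inv, ENNReal.toReal_ofNat, smul_eq_mul]
  ring

end
end

section
/- Let a ≥ 0, b > 0, α, α_0, κ, ε > 0, let U : ℝ^{2d} → ℝ^d be continuous, let ν be a nonnegative Borel measure on ℝ^d with ν({0}) = 0 and ∫(1 ∧ |u|²)ν(du) < ∞, and let ν* ≤ ν. Let f : [0,∞) → [0,∞) be C¹ and concave with f(0) = 0, and let 𝒲 : ℝ^{2d} → [1,∞) be C^{1,2}. With z = x − x', w = v − v', q = z + α^{-1}w, r = α_0|z| + |q|, H((x,v),(x',v')) := f(r) and G((x,v),(x',v')) := 1 + ε(𝒲(x,v) + 𝒲(x',v')), suppose that at a point ((x,v),(x',v')) with z ≠ 0 and q ≠ 0 all the integrals defining (𝓛̃ H), (𝓛̃ G), (𝓛̃ (HG)) and Π converge absolutely. Then (𝓛̃(HG))((x,v),(x',v'))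 = H((x,v),(x',v'))·(𝓛̃ G)((x,v),(x',v')) + G((x,v),(x',v'))·(𝓛̃ H)((x,v),(x',v')) + Π((x,v),(x',v')), where Π((x,v),(x',v')) := (1/2)∫ [H((x,v+u),(x',v'+u+α(q)_κ)) − H((x,v),(x',v'))]·[G((x,v+u),(x',v'+u+α(q)_κ)) − G((x,v),(x',v'))] ν*_{−α(q)_κ}(du) + (1/2)∫ [H((x,v+u),(x',v'+u−α(q)_κ)) − H((x,v),(x',v'))]·[G((x,v+u),(x',v'+u−α(q)_κ)) − G((x,v),(x',v'))] ν*_{α(q)_κ}(du). -/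
open MeasureTheory Set
open scoped ENNReal RealInnerProductSpace

noncomputable section

/-- Pointwise product rule for the integrand of the `+α(q)_κ` jump part. -/
theorem jumpP_mul {d : ℕ} (α κ : ℝ) (q : EuclideanSpace ℝ (Fin d))
    (H G : EuclideanSpace ℝ (Fin d) → EuclideanSpace ℝ (Fin d) → ℝ)
    (v v' u : EuclideanSpace ℝ (Fin d))
    (hH₁ : DifferentiableAt ℝ (fun w => H w v') v) (hH₂ : DifferentiableAt ℝ (fun w => H v w) v')
    (hG₁ : DifferentiableAt ℝ (fun w => G w v') v) (hG₂ : DifferentiableAt ℝ (fun w => G v w) v') :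
    jumpP α κ q (fun w w' => H w w' * G w w') v v' u =
      H v v' * jumpP α κ q G v v' u + G v v' * jumpP α κ q H v v' u
        + (H (v + u) (v' + u + α • trunc κ q) - H v v')
          * (G (v + u) (v' + u + α • trunc κ q) - G v v') := by
  simp only [jumpP, fderiv_fun_mul hH₁ hG₁, fderiv_fun_mul hH₂ hG₂, add_apply,
    smul_apply, smul_eq_mul]
  split_ifs <;> ring

/-- Pointwise product rule for the integrand of the `−α(q)_κ` jump part. -/
theorem jumpM_mul {d : ℕ} (α κ : ℝ) (q : EuclideanSpace ℝ (Fin d))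
    (H G : EuclideanSpace ℝ (Fin d) → EuclideanSpace ℝ (Fin d) → ℝ)
    (v v' u : EuclideanSpace ℝ (Fin d))
    (hH₁ : DifferentiableAt ℝ (fun w => H w v') v) (hH₂ : DifferentiableAt ℝ (fun w => H v w) v')
    (hG₁ : DifferentiableAt ℝ (fun w => G w v') v) (hG₂ : DifferentiableAt ℝ (fun w => G v w) v') :
    jumpM α κ q (fun w w' => H w w' * G w w') v v' u =
      H v v' * jumpM α κ q G v v' u + G v v' * jumpM α κ q H v v' u
        + (H (v + u) (v' + u - α • trunc κ q) - H v v')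
          * (G (v + u) (v' + u - α • trunc κ q) - G v v') := by
  simp only [jumpM, fderiv_fun_mul hH₁ hG₁, fderiv_fun_mul hH₂ hG₂, add_apply,
    smul_apply, smul_eq_mul]
  split_ifs <;> ring

/-- Pointwise product rule for the synchronous integrand; there is no correction term when `H` is
invariant under simultaneous translations. -/
theorem jumpS_mul {d : ℕ} (H G : EuclideanSpace ℝ (Fin d) → EuclideanSpace ℝ (Fin d) → ℝ)
    (v v' u : EuclideanSpace ℝ (Fin d)) (hinv : H (v + u) (v' + u) = H v v')
    (hH₁ : DifferentiableAt ℝ (fun w => H w v') v) (hH₂ : DifferentiableAt ℝ (fun w => H v w) v')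
    (hG₁ : DifferentiableAt ℝ (fun w => G w v') v) (hG₂ : DifferentiableAt ℝ (fun w => G v w) v') :
    jumpS (fun w w' => H w w' * G w w') v v' u =
      H v v' * jumpS G v v' u + G v v' * jumpS H v v' u := by
  simp only [jumpS, fderiv_fun_mul hH₁ hG₁, fderiv_fun_mul hH₂ hG₂, add_apply,
    smul_apply, smul_eq_mul, hinv]
  split_ifs <;> ring

/-- Product rule for the jump part of the coupling operator. -/
theorem couplingJump_mul {d : ℕ} (ν νstar : Measure (EuclideanSpace ℝ (Fin d))) (α κ : ℝ)
    (q : EuclideanSpace ℝ (Fin d))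
    (H G : EuclideanSpace ℝ (Fin d) → EuclideanSpace ℝ (Fin d) → ℝ)
    (v v' : EuclideanSpace ℝ (Fin d)) (hinv : ∀ u, H (v + u) (v' + u) = H v v')
    (hH₁ : DifferentiableAt ℝ (fun w => H w v') v) (hH₂ : DifferentiableAt ℝ (fun w => H v w) v')
    (hG₁ : DifferentiableAt ℝ (fun w => G w v') v) (hG₂ : DifferentiableAt ℝ (fun w => G v w) v')
    (hintH : JumpIntegrable ν νstar α κ q H v v') (hintG : JumpIntegrable ν νstar α κ q G v v')
    (hP : Integrable (fun u => (H (v + u) (v' + u + α • trunc κ q) - H v v')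
      * (G (v + u) (v' + u + α • trunc κ q) - G v v')) (nuInf νstar (-(α • trunc κ q))))
    (hM : Integrable (fun u => (H (v + u) (v' + u - α • trunc κ q) - H v v')
      * (G (v + u) (v' + u - α • trunc κ q) - G v v')) (nuInf νstar (α • trunc κ q))) :
    couplingJump ν νstar α κ q (fun w w' => H w w' * G w w') v v' =
      H v v' * couplingJump ν νstar α κ q G v v' + G v v' * couplingJump ν νstar α κ q H v v'
        + PiCorr νstar α κ q H G v v' := by
  obtain ⟨hHP, hHM, hHS⟩ := hintH
  obtain ⟨hGP, hGM, hGS⟩ := hintG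
  simp only [couplingJump, PiCorr, jumpP_mul α κ q H G v v' _ hH₁ hH₂ hG₁ hG₂,
    jumpM_mul α κ q H G v v' _ hH₁ hH₂ hG₁ hG₂,
    jumpS_mul H G v v' _ (hinv _) hH₁ hH₂ hG₁ hG₂]
  rw [integral_add ((hGP.const_mul _).fun_add (hHP.const_mul _)) hP,
    integral_add (hGP.const_mul _) (hHP.const_mul _),
    integral_add ((hGM.const_mul _).fun_add (hHM.const_mul _)) hM,
    integral_add (hGM.const_mul _) (hHM.const_mul _),
    integral_add (hGS.const_mul _) (hHS.const_mul _)]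
  simp only [integral_const_mul]
  ring

/-- `H` composed with curves through a point with `z ≠ 0`, `q ≠ 0` is differentiable there. -/
theorem differentiableAt_Hfun_comp {d : ℕ} {f : ℝ → ℝ} (hf : ContDiffOn ℝ 1 f (Set.Ici 0))
    {α α₀ : ℝ} (hα₀ : 0 < α₀) {X V X' V' : EuclideanSpace ℝ (Fin d) → EuclideanSpace ℝ (Fin d)}
    {p : EuclideanSpace ℝ (Fin d)} (hX : DifferentiableAt ℝ X p) (hV : DifferentiableAt ℝ V p)
    (hX' : DifferentiableAt ℝ X' p) (hV' : DifferentiableAt ℝ V' p)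
    (hz : X p - X' p ≠ 0) (hq : (X p - X' p) + α⁻¹ • (V p - V' p) ≠ 0) :
    DifferentiableAt ℝ (fun y => Hfun f α α₀ (X y) (V y) (X' y) (V' y)) p := by
  have hr : 0 < α₀ * ‖X p - X' p‖ + ‖(X p - X' p) + α⁻¹ • (V p - V' p)‖ :=
    add_pos (mul_pos hα₀ (norm_pos_iff.mpr hz)) (norm_pos_iff.mpr hq)
  have hfd : DifferentiableAt ℝ f (α₀ * ‖X p - X' p‖ + ‖(X p - X' p) + α⁻¹ • (V p - V' p)‖) :=
    (hf.contDiffAt (Ici_mem_nhds hr)).differentiableAt one_ne_zero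
  have hz' := (hX.sub hX').norm ℝ hz
  have hq' := ((hX.sub hX').add ((hV.sub hV').const_smul α⁻¹)).norm ℝ hq
  exact hfd.comp p ((hz'.const_mul α₀).add hq')

/-- the product rule for the coupling operator. With
`H((x,v),(x',v')) = f(α₀|z| + |q|)` and `G = 1 + ε(𝒲(x,v)+𝒲(x',v'))`, at a point where
`z ≠ 0`, `q ≠ 0` and all the integrals defining `𝓛̃H`, `𝓛̃G`, `𝓛̃(HG)` and `Π` converge
absolutely, one has `𝓛̃(HG) = H·(𝓛̃G) + G·(𝓛̃H) + Π`. -/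
theorem stmt3 (d : ℕ) (a b α α₀ κ ε : ℝ)
    (ha : 0 ≤ a) (hb : 0 < b) (hα : 0 < α) (hα₀ : 0 < α₀) (hκ : 0 < κ) (hε : 0 < ε)
    (U : EuclideanSpace ℝ (Fin d) × EuclideanSpace ℝ (Fin d) → EuclideanSpace ℝ (Fin d))
    (hU : Continuous U)
    (ν νstar : Measure (EuclideanSpace ℝ (Fin d)))
    (hν0 : ν {0} = 0)
    (hν : ∫⁻ u, ENNReal.ofReal (min 1 (‖u‖ ^ 2)) ∂ν < ∞)
    (hle : νstar ≤ ν)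
    (f : ℝ → ℝ) (hf0 : f 0 = 0)
    (hf : ContDiffOn ℝ 1 f (Set.Ici 0))
    (hfconc : ConcaveOn ℝ (Set.Ici 0) f)
    (W : EuclideanSpace ℝ (Fin d) → EuclideanSpace ℝ (Fin d) → ℝ)
    (hW1 : ∀ x v, 1 ≤ W x v)
    (hWx : ∀ v, ContDiff ℝ 1 (fun x => W x v))
    (hWv : ∀ x, ContDiff ℝ 2 (fun v => W x v))
    (x v x' v' : EuclideanSpace ℝ (Fin d))
    (hz : x - x' ≠ 0) (hq : (x - x') + α⁻¹ • (v - v') ≠ 0)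
    (hintH : JumpIntegrable ν νstar α κ ((x - x') + α⁻¹ • (v - v'))
      (fun w w' => Hfun f α α₀ x w x' w') v v')
    (hintG : JumpIntegrable ν νstar α κ ((x - x') + α⁻¹ • (v - v'))
      (fun w w' => Gfun W ε x w x' w') v v')
    (hintHG : JumpIntegrable ν νstar α κ ((x - x') + α⁻¹ • (v - v'))
      (fun w w' => Hfun f α α₀ x w x' w' * Gfun W ε x w x' w') v v')
    (hintPi1 : Integrable (fun u =>
        (Hfun f α α₀ x (v + u) x' (v' + u + α • trunc κ ((x - x') + α⁻¹ • (v - v')))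
            - Hfun f α α₀ x v x' v')
          * (Gfun W ε x (v + u) x' (v' + u + α • trunc κ ((x - x') + α⁻¹ • (v - v')))
            - Gfun W ε x v x' v'))
        (nuInf νstar (-(α • trunc κ ((x - x') + α⁻¹ • (v - v'))))))
    (hintPi2 : Integrable (fun u =>
        (Hfun f α α₀ x (v + u) x' (v' + u - α • trunc κ ((x - x') + α⁻¹ • (v - v')))
            - Hfun f α α₀ x v x' v')
          * (Gfun W ε x (v + u) x' (v' + u - α • trunc κ ((x - x') + α⁻¹ • (v - v')))
            - Gfun W ε x v x' v'))
        (nuInf νstar (α • trunc κ ((x - x') + α⁻¹ • (v - v'))))) :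
    couplingOp ν νstar a b α κ U
        (fun y w y' w' => Hfun f α α₀ y w y' w' * Gfun W ε y w y' w') x v x' v' =
      Hfun f α α₀ x v x' v' * couplingOp ν νstar a b α κ U (Gfun W ε) x v x' v'
        + Gfun W ε x v x' v' * couplingOp ν νstar a b α κ U (Hfun f α α₀) x v x' v'
        + PiCorr νstar α κ ((x - x') + α⁻¹ • (v - v'))
            (fun w w' => Hfun f α α₀ x w x' w') (fun w w' => Gfun W ε x w x' w') v v' := by
  have hHx : DifferentiableAt ℝ (fun y => Hfun f α α₀ y v x' v') x :=
    differentiableAt_Hfun_comp (X := fun y => y) hf hα₀ (by fun_prop) (by fun_prop) (by fun_prop)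
      (by fun_prop) hz hq
  have hHx' : DifferentiableAt ℝ (fun y => Hfun f α α₀ x v y v') x' :=
    differentiableAt_Hfun_comp (X' := fun y => y) hf hα₀ (by fun_prop) (by fun_prop) (by fun_prop)
      (by fun_prop) hz hq
  have hHv : DifferentiableAt ℝ (fun w => Hfun f α α₀ x w x' v') v :=
    differentiableAt_Hfun_comp (V := fun y => y) hf hα₀ (by fun_prop) (by fun_prop) (by fun_prop)
      (by fun_prop) hz hq
  have hHv' : DifferentiableAt ℝ (fun w => Hfun f α α₀ x v x' w) v' :=
    differentiableAt_Hfun_comp (V' := fun y => y) hf hα₀ (by fun_prop) (by fun_prop) (by fun_prop)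
      (by fun_prop) hz hq
  have hWx_diff (v) : Differentiable ℝ (fun y => W y v) := (hWx v).differentiable one_ne_zero
  have hWv_diff (x) : Differentiable ℝ (fun w => W x w) := (hWv x).differentiable two_ne_zero
  have hGx : DifferentiableAt ℝ (fun y => Gfun W ε y v x' v') x :=
    (((hWx_diff v x).add_const _).const_mul ε).const_add 1
  have hGx' : DifferentiableAt ℝ (fun y => Gfun W ε x v y v') x' :=
    (((hWx_diff v' x').const_add _).const_mul ε).const_add 1
  have hGv : DifferentiableAt ℝ (fun w => Gfun W ε x w x' v') v :=
    (((hWv_diff x v).add_const _).const_mul ε).const_add 1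
  have hGv' : DifferentiableAt ℝ (fun w => Gfun W ε x v x' w) v' :=
    (((hWv_diff x' v').const_add _).const_mul ε).const_add 1
  have hjump := couplingJump_mul ν νstar α κ ((x - x') + α⁻¹ • (v - v'))
    (fun w w' => Hfun f α α₀ x w x' w') (fun w w' => Gfun W ε x w x' w') v v'
    (fun u => by simp only [Hfun, add_sub_add_right_eq_sub]) hHv hHv' hGv hGv' hintH hintG
    hintPi1 hintPi2
  simp only [couplingOp, hjump, fderiv_fun_mul hHx hGx, fderiv_fun_mul hHx' hGx',
    fderiv_fun_mul hHv hGv, fderiv_fun_mul hHv' hGv', add_apply,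
    smul_apply, smul_eq_mul]
  ring

end
end

section
/- Let a ≥ 0, b > 0, α, α_0, κ > 0, let U : ℝ^{2d} → ℝ^d, let ν be a nonnegative Borel measure on ℝ^d with ν({0}) = 0 and ∫(1 ∧ |u|²)ν(du) < ∞, and let ν* ≤ ν. Let f : [0,∞) → ℝ be C¹. With z = x − x', w = v − v', q = z + α^{-1}w, r = α_0|z| + |q| and H((x,v),(x',v')) := f(r), for every point with z ≠ 0 and q ≠ 0 one has (𝓛̃ H)((x,v),(x',v')) = f'(r)·{ α_0(a − bα)|z| + (bαα_0/|z|)⟨z, q⟩ + (1/|q|)⟨q, az + bw + α^{-1}(U(x,v) − U(x',v'))⟩ } + (1/2)·( f(r + κ∧|q|) + f(r − (κ∧|q|)) − 2f(r) )·ν*_{α(q)_κ}(ℝ^d). -/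
open MeasureTheory Set
open scoped ENNReal RealInnerProductSpace

noncomputable section

/-- Chain rule for `f (c‖Z‖ + ‖Q‖)` at a point where neither `Z` nor `Q` vanishes. -/
theorem fderiv_comp_weighted_norms {E F : Type*} [NormedAddCommGroup E] [NormedSpace ℝ E]
    [NormedAddCommGroup F] [InnerProductSpace ℝ F] {f : ℝ → ℝ} {c : ℝ} {Z Q : E → F}
    {Z' Q' : E →L[ℝ] F} {x : E} (hZ : HasFDerivAt Z Z' x) (hQ : HasFDerivAt Q Q' x)
    (hZ0 : Z x ≠ 0) (hQ0 : Q x ≠ 0) (hf : DifferentiableAt ℝ f (c * ‖Z x‖ + ‖Q x‖)) (h : E) :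
    fderiv ℝ (fun y => f (c * ‖Z y‖ + ‖Q y‖)) x h =
      deriv f (c * ‖Z x‖ + ‖Q x‖) * (c * (⟪Z x, Z' h⟫ / ‖Z x‖) + ⟪Q x, Q' h⟫ / ‖Q x‖) := by
  have hnorm : ∀ {G : E → F} {G' : E →L[ℝ] F}, HasFDerivAt G G' x → G x ≠ 0 →
      ∃ L : E →L[ℝ] ℝ, HasFDerivAt (fun y => ‖G y‖) L x ∧ L h = ⟪G x, G' h⟫ / ‖G x‖ := by
    intro G G' hG hG0
    have hpos : 0 < ‖G x‖ := norm_pos_iff.2 hG0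
    have hsqrt := hG.norm_sq.sqrt (by positivity)
    simp only [Real.sqrt_sq (norm_nonneg _)] at hsqrt
    refine ⟨_, hsqrt, ?_⟩
    simp
    field_simp
  obtain ⟨L, hL, hLh⟩ := hnorm hZ hZ0
  obtain ⟨M, hM, hMh⟩ := hnorm hQ hQ0
  have key := hf.hasDerivAt.comp_hasFDerivAt x ((hL.const_mul c).add hM)
  have hfd : fderiv ℝ (fun y => f (c * ‖Z y‖ + ‖Q y‖)) x =
      deriv f (c * ‖Z x‖ + ‖Q x‖) • (c • L + M) := key.fderiv
  rw [hfd]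
  simp only [add_apply, smul_apply, smul_eq_mul, hLh, hMh]

theorem map_add_nuInf_neg {d : ℕ} (νstar : Measure (EuclideanSpace ℝ (Fin d)))
    (y : EuclideanSpace ℝ (Fin d)) :
    (nuInf νstar (-y)).map (fun u => u + y) = nuInf νstar y := by
  have hadd : ∀ a : EuclideanSpace ℝ (Fin d), Measurable fun u => u + a :=
    fun a => measurable_add_const a
  have hle : ∀ a : EuclideanSpace ℝ (Fin d),
      (nuInf νstar (-a)).map (fun u => u + a) ≤ nuInf νstar a := by
    intro a
    refine le_inf ?_ (Measure.map_mono inf_le_left (hadd a))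
    refine (Measure.map_mono inf_le_right (hadd a)).trans_eq ?_
    rw [Measure.map_map (hadd _) (hadd _)]
    simp [Function.comp_def]
  refine le_antisymm (hle y) ?_
  have h := Measure.map_mono (hle (-y)) (hadd y)
  rw [Measure.map_map (hadd _) (hadd _)] at h
  simpa [Function.comp_def] using h

/-- A Lévy measure is finite away from the origin. -/
theorem levy_measure_norm_ge_lt_top {d : ℕ} {ν : Measure (EuclideanSpace ℝ (Fin d))}
    (hν : ∫⁻ u, ENNReal.ofReal (min 1 (‖u‖ ^ 2)) ∂ν < ∞) {ε : ℝ} (hε : 0 < ε) :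
    ν {u | ε ≤ ‖u‖} < ∞ := by
  have hpos : 0 < min 1 (ε ^ 2) := by positivity
  have hmeas : Measurable fun u : EuclideanSpace ℝ (Fin d) =>
      ENNReal.ofReal (min 1 (‖u‖ ^ 2)) := by fun_prop
  refine lt_of_le_of_lt (measure_mono ?_)
    ((meas_ge_le_lintegral_div hmeas.aemeasurable
      (ENNReal.ofReal_pos.2 hpos).ne' ENNReal.ofReal_ne_top).trans_lt
        (ENNReal.div_lt_top hν.ne (ENNReal.ofReal_pos.2 hpos).ne'))
  intro u hu
  have hu : ε ≤ ‖u‖ := hu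
  change ENNReal.ofReal (min 1 (ε ^ 2)) ≤ ENNReal.ofReal (min 1 (‖u‖ ^ 2))
  gcongr

theorem isFiniteMeasure_nuInf {d : ℕ} {ν νstar : Measure (EuclideanSpace ℝ (Fin d))}
    (hν : ∫⁻ u, ENNReal.ofReal (min 1 (‖u‖ ^ 2)) ∂ν < ∞) (hle : νstar ≤ ν)
    {y : EuclideanSpace ℝ (Fin d)} (hy : y ≠ 0) : IsFiniteMeasure (nuInf νstar y) := by
  have hpos : 0 < ‖y‖ / 2 := half_pos (norm_pos_iff.2 hy)
  have hfar := levy_measure_norm_ge_lt_top hν hpos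
  have hmeas : MeasurableSet {u : EuclideanSpace ℝ (Fin d) | ‖y‖ / 2 ≤ ‖u‖} :=
    measurableSet_le measurable_const measurable_norm
  have h1 : nuInf νstar y {u | ‖y‖ / 2 ≤ ‖u‖} < ∞ :=
    ((Measure.le_iff'.1 (inf_le_left.trans hle)) _).trans_lt hfar
  have h2 : nuInf νstar y {u | ‖y‖ / 2 ≤ ‖u‖}ᶜ < ∞ := by
    refine ((Measure.le_iff'.1 inf_le_right) _).trans_lt ?_
    rw [Measure.map_apply (measurable_add_const y) hmeas.compl]
    refine (((Measure.le_iff'.1 hle) _).trans (measure_mono ?_)).trans_lt hfar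
    intro u hu
    simp only [mem_preimage, mem_compl_iff, mem_ofPred_eq, not_le] at hu ⊢
    have := norm_sub_le (u + y) u
    rw [add_sub_cancel_left] at this
    linarith
  refine ⟨?_⟩
  rw [← measure_add_measure_compl hmeas]
  exact ENNReal.add_lt_top.2 ⟨h1, h2⟩

/-- The compensators of the two reflected jumps cancel after translation. -/
theorem integral_nuInf_neg_add_integral_nuInf {d : ℕ}
    {νstar : Measure (EuclideanSpace ℝ (Fin d))} {y : EuclideanSpace ℝ (Fin d)}
    [IsFiniteMeasure (nuInf νstar y)] {g : EuclideanSpace ℝ (Fin d) → ℝ} (hg : Measurable g)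
    {C : ℝ} (hC : ∀ u, ‖g u‖ ≤ C) (c₁ c₂ : ℝ) :
    (∫ u, (c₁ - g u + g (u + y)) ∂(nuInf νstar (-y)))
      + (∫ u, (c₂ - g u + g (u - y)) ∂(nuInf νstar y))
      = (c₁ + c₂) * (nuInf νstar y univ).toReal := by
  have hmap : nuInf νstar (-y) = (nuInf νstar y).map (fun u => u + -y) := by
    simpa using (map_add_nuInf_neg νstar (-y)).symm
  have hi : Integrable g (nuInf νstar y) :=
    Integrable.of_bound hg.aestronglyMeasurable C (Filter.Eventually.of_forall hC)
  have hi' : Integrable (fun u => g (u - y)) (nuInf νstar y) :=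
    Integrable.of_bound (hg.comp (measurable_sub_const y)).aestronglyMeasurable C
      (Filter.Eventually.of_forall fun u => hC _)
  rw [hmap, integral_map (measurable_add_const _).aemeasurable
    (by fun_prop)]
  simp only [← sub_eq_add_neg, sub_add_cancel]
  have hi₁ : Integrable (fun u => c₁ - g (u - y) + g u) (nuInf νstar y) :=
    ((integrable_const _).sub hi').add hi
  have hi₂ : Integrable (fun u => c₂ - g u + g (u - y)) (nuInf νstar y) :=
    ((integrable_const _).sub hi).add hi'
  rw [← integral_add hi₁ hi₂]
  have : ∀ u, c₁ - g (u - y) + g u + (c₂ - g u + g (u - y)) = c₁ + c₂ := fun u => by ring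
  simp [this, Measure.real, mul_comm]

theorem norm_sub_trunc {d : ℕ} {κ : ℝ} {q : EuclideanSpace ℝ (Fin d)} (hq : q ≠ 0) :
    ‖q - trunc κ q‖ = ‖q‖ - min κ ‖q‖ := by
  have hpos : 0 < ‖q‖ := norm_pos_iff.2 hq
  have h : q - trunc κ q = (1 - min 1 (κ / ‖q‖)) • q := by rw [trunc, sub_smul, one_smul]
  rw [h, norm_smul, Real.norm_of_nonneg (by simp), sub_mul, one_mul,
    min_mul_of_nonneg _ _ hpos.le, div_mul_cancel₀ _ hpos.ne', one_mul, min_comm]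

theorem norm_add_trunc {d : ℕ} {κ : ℝ} (hκ : 0 < κ) {q : EuclideanSpace ℝ (Fin d)}
    (hq : q ≠ 0) : ‖q + trunc κ q‖ = ‖q‖ + min κ ‖q‖ := by
  have hpos : 0 < ‖q‖ := norm_pos_iff.2 hq
  have h : q + trunc κ q = (1 + min 1 (κ / ‖q‖)) • q := by rw [trunc, add_smul, one_smul]
  rw [h, norm_smul, Real.norm_of_nonneg (by positivity), add_mul, one_mul,
    min_mul_of_nonneg _ _ hpos.le, div_mul_cancel₀ _ hpos.ne', one_mul, min_comm]

theorem trunc_ne_zero {d : ℕ} {κ : ℝ} (hκ : 0 < κ) {q : EuclideanSpace ℝ (Fin d)}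
    (hq : q ≠ 0) : trunc κ q ≠ 0 := by
  have hpos : 0 < ‖q‖ := norm_pos_iff.2 hq
  exact smul_ne_zero (by positivity) hq

/-- the action of the coupling operator on the distance function
`H((x,v),(x',v')) = f(α₀|z| + |q|)` (with `z = x − x'`, `w = v − v'`, `q = z + α⁻¹w`,
`r = α₀|z| + |q|`) at points with `z ≠ 0`, `q ≠ 0`:
`(𝓛̃H) = f'(r)·{α₀(a−bα)|z| + (bαα₀/|z|)⟨z,q⟩ + (1/|q|)⟨q, az + bw + α⁻¹(U(x,v)−U(x',v'))⟩}
 + (1/2)(f(r+κ∧|q|) + f(r−(κ∧|q|)) − 2f(r))·ν*_{α(q)_κ}(ℝ^d)`. -/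
theorem stmt4 (d : ℕ) (a b α α₀ κ : ℝ)
    (ha : 0 ≤ a) (hb : 0 < b) (hα : 0 < α) (hα₀ : 0 < α₀) (hκ : 0 < κ)
    (U : EuclideanSpace ℝ (Fin d) × EuclideanSpace ℝ (Fin d) → EuclideanSpace ℝ (Fin d))
    (ν νstar : Measure (EuclideanSpace ℝ (Fin d)))
    (hν0 : ν {0} = 0)
    (hν : ∫⁻ u, ENNReal.ofReal (min 1 (‖u‖ ^ 2)) ∂ν < ∞)
    (hle : νstar ≤ ν)
    (f : ℝ → ℝ) (hf : ContDiffOn ℝ 1 f (Set.Ici 0))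
    (x v x' v' z w q : EuclideanSpace ℝ (Fin d)) (r : ℝ)
    (hzdef : z = x - x') (hwdef : w = v - v') (hqdef : q = z + α⁻¹ • w)
    (hrdef : r = α₀ * ‖z‖ + ‖q‖)
    (hz : z ≠ 0) (hq : q ≠ 0) :
    couplingOp ν νstar a b α κ U (Hfun f α α₀) x v x' v' =
      deriv f r *
        (α₀ * (a - b * α) * ‖z‖ + (b * α * α₀ / ‖z‖) * ⟪z, q⟫
          + (1 / ‖q‖) * ⟪q, a • z + b • w + α⁻¹ • (U (x, v) - U (x', v'))⟫)
      + (1 / 2) * (f (r + min κ ‖q‖) + f (r - min κ ‖q‖) - 2 * f r)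
          * ((nuInf νstar (α • trunc κ q)) Set.univ).toReal := by
  have hzpos : 0 < ‖z‖ := norm_pos_iff.2 hz
  have hqpos : 0 < ‖q‖ := norm_pos_iff.2 hq
  have hrpos : 0 < r := by rw [hrdef]; positivity
  have hfr : DifferentiableAt ℝ f r :=
    (hf.differentiableOn one_ne_zero).differentiableAt (Ici_mem_nhds hrpos)
  have hq' : (x - x') + α⁻¹ • (v - v') = q := by rw [hqdef, hzdef, hwdef]
  have hr' : α₀ * ‖x - x'‖ + ‖(x - x') + α⁻¹ • (v - v')‖ = r := by rw [hq', hrdef, hzdef]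
  have hzx : x - x' ≠ 0 := hzdef ▸ hz
  have hqx : (x - x') + α⁻¹ • (v - v') ≠ 0 := hq'.symm ▸ hq
  have hfr' : DifferentiableAt ℝ f (α₀ * ‖x - x'‖ + ‖(x - x') + α⁻¹ • (v - v')‖) := by rwa [hr']
  have hdx : ∀ h, fderiv ℝ (fun y => Hfun f α α₀ y v x' v') x h =
      deriv f r * (α₀ * (⟪z, h⟫ / ‖z‖) + ⟪q, h⟫ / ‖q‖) := by
    intro h
    have hZ : HasFDerivAt (fun y => y - x') (ContinuousLinearMap.id ℝ _) x :=
      (hasFDerivAt_id x).sub_const x'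
    refine (fderiv_comp_weighted_norms hZ (hZ.add_const (α⁻¹ • (v - v'))) hzx hqx hfr' h).trans ?_
    simp only [hq']
    simp only [← hzdef, ← hrdef, ContinuousLinearMap.id_apply]
  have hdx' : ∀ h, fderiv ℝ (fun y => Hfun f α α₀ x v y v') x' h =
      -(deriv f r * (α₀ * (⟪z, h⟫ / ‖z‖) + ⟪q, h⟫ / ‖q‖)) := by
    intro h
    have hZ : HasFDerivAt (fun y => x - y) (-ContinuousLinearMap.id ℝ _) x' :=
      (hasFDerivAt_id x').const_sub x
    refine (fderiv_comp_weighted_norms hZ (hZ.add_const (α⁻¹ • (v - v'))) hzx hqx hfr' h).trans ?_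
    simp only [hq']
    simp only [← hzdef, ← hrdef, neg_apply, ContinuousLinearMap.id_apply, inner_neg_right]
    ring
  have hdv : ∀ h, fderiv ℝ (fun y => Hfun f α α₀ x y x' v') v h =
      deriv f r * (α⁻¹ * (⟪q, h⟫ / ‖q‖)) := by
    intro h
    have hQ : HasFDerivAt (fun y => (x - x') + α⁻¹ • (y - v'))
        (α⁻¹ • ContinuousLinearMap.id ℝ (EuclideanSpace ℝ (Fin d))) v :=
      (((hasFDerivAt_id v).sub_const v').const_smul α⁻¹).const_add (x - x')
    refine (fderiv_comp_weighted_norms (hasFDerivAt_const (x - x') v) hQ hzx hqx hfr' h).trans ?_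
    simp only [hq']
    simp only [← hzdef, ← hrdef, smul_apply, zero_apply, ContinuousLinearMap.id_apply,
      inner_zero_right, inner_smul_right]
    ring
  have hdv' : ∀ h, fderiv ℝ (fun y => Hfun f α α₀ x v x' y) v' h =
      -(deriv f r * (α⁻¹ * (⟪q, h⟫ / ‖q‖))) := by
    intro h
    have hQ : HasFDerivAt (fun y => (x - x') + α⁻¹ • (v - y))
        (α⁻¹ • -ContinuousLinearMap.id ℝ (EuclideanSpace ℝ (Fin d))) v' :=
      (((hasFDerivAt_id v').const_sub v).const_smul α⁻¹).const_add (x - x')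
    refine (fderiv_comp_weighted_norms (hasFDerivAt_const (x - x') v') hQ hzx hqx hfr' h).trans ?_
    simp only [hq']
    simp only [← hzdef, ← hrdef, smul_apply, zero_apply, neg_apply, ContinuousLinearMap.id_apply,
      inner_zero_right, inner_smul_right, inner_neg_right]
    ring
  have hjump : couplingJump ν νstar α κ q (fun w w' => Hfun f α α₀ x w x' w') v v' =
      (1 / 2) * (f (r + min κ ‖q‖) + f (r - min κ ‖q‖) - 2 * f r)
          * ((nuInf νstar (α • trunc κ q)) Set.univ).toReal := by
    have hH : Hfun f α α₀ x v x' v' = f r := by rw [Hfun, hr']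
    have hHP : ∀ u, Hfun f α α₀ x (v + u) x' (v' + u + α • trunc κ q) =
        f (r - min κ ‖q‖) := by
      intro u
      have h : (x - x') + α⁻¹ • (v + u - (v' + u + α • trunc κ q)) = q - trunc κ q := by
        rw [show v + u - (v' + u + α • trunc κ q) = (v - v') - α • trunc κ q by abel, smul_sub,
          inv_smul_smul₀ hα.ne', ← hq']
        abel
      rw [Hfun, h, norm_sub_trunc hq, ← hzdef, hrdef, add_sub_assoc]
    have hHM : ∀ u, Hfun f α α₀ x (v + u) x' (v' + u - α • trunc κ q) =
        f (r + min κ ‖q‖) := by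
      intro u
      have h : (x - x') + α⁻¹ • (v + u - (v' + u - α • trunc κ q)) = q + trunc κ q := by
        rw [show v + u - (v' + u - α • trunc κ q) = (v - v') + α • trunc κ q by abel, smul_add,
          inv_smul_smul₀ hα.ne', ← hq']
        abel
      rw [Hfun, h, norm_add_trunc hκ hq, ← hzdef, hrdef, add_assoc]
    have hHS : ∀ u, Hfun f α α₀ x (v + u) x' (v' + u) = f r := by
      intro u
      rw [Hfun, add_sub_add_right_eq_sub, hr']
    let g : EuclideanSpace ℝ (Fin d) → ℝ := fun u =>
      if ‖u‖ ≤ 1 then deriv f r * (α⁻¹ * (⟪q, u⟫ / ‖q‖)) else 0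
    have hg : Measurable g :=
      Measurable.ite (measurableSet_le measurable_norm measurable_const) (by fun_prop)
        measurable_const
    have hgC : ∀ u, ‖g u‖ ≤ |deriv f r| * α⁻¹ := by
      intro u
      by_cases hu : ‖u‖ ≤ 1
      · have hinner : |⟪q, u⟫ / ‖q‖| ≤ 1 := by
          rw [abs_div, abs_norm, div_le_one hqpos]
          exact (abs_real_inner_le_norm q u).trans (mul_le_of_le_one_right hqpos.le hu)
        simp only [g, if_pos hu, Real.norm_eq_abs, abs_mul, abs_of_pos (inv_pos.2 hα)]
        gcongr
        exact mul_le_of_le_one_right (inv_pos.2 hα).le hinner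
      · simp only [g, if_neg hu, norm_zero]
        positivity
    have hP : ∀ u, jumpP α κ q (fun w w' => Hfun f α α₀ x w x' w') v v' u =
        (f (r - min κ ‖q‖) - f r) - g u + g (u + α • trunc κ q) := by
      intro u
      simp only [jumpP, hHP, hH, hdv, hdv', g]
      split_ifs <;> ring
    have hM : ∀ u, jumpM α κ q (fun w w' => Hfun f α α₀ x w x' w') v v' u =
        (f (r + min κ ‖q‖) - f r) - g u + g (u - α • trunc κ q) := by
      intro u
      simp only [jumpM, hHM, hH, hdv, hdv', g]
      split_ifs <;> ring
    have hS : ∀ u, jumpS (fun w w' => Hfun f α α₀ x w x' w') v v' u = 0 := by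
      intro u
      simp only [jumpS, hHS, hH, hdv, hdv']
      split_ifs <;> ring
    have := isFiniteMeasure_nuInf hν hle (smul_ne_zero hα.ne' (trunc_ne_zero hκ hq))
    simp only [couplingJump, hP, hM, hS, integral_zero, add_zero]
    rw [← mul_add, integral_nuInf_neg_add_integral_nuInf hg hgC]
    ring
  have hdrift : a • x + b • v - (a • x' + b • v') = a • z + b • w := by
    rw [hzdef, hwdef, smul_sub, smul_sub]
    abel
  have hw : w = α • (q - z) := by rw [hqdef, add_sub_cancel_left, smul_inv_smul₀ hα.ne']
  have hzdrift : ⟪z, a • x + b • v⟫ - ⟪z, a • x' + b • v'⟫ =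
      a * ‖z‖ ^ 2 + b * α * (⟪z, q⟫ - ‖z‖ ^ 2) := by
    rw [← inner_sub_right, hdrift, hw, inner_add_right, inner_smul_right, inner_smul_right,
      inner_smul_right, inner_sub_right, real_inner_self_eq_norm_sq]
    ring
  have hqdrift : ⟪q, a • z + b • w + α⁻¹ • (U (x, v) - U (x', v'))⟫ =
      (⟪q, a • x + b • v⟫ - ⟪q, a • x' + b • v'⟫)
        + α⁻¹ * (⟪q, U (x, v)⟫ - ⟪q, U (x', v')⟫) := by
    rw [← hdrift, inner_add_right, inner_smul_right, inner_sub_right, inner_sub_right]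
  rw [couplingOp, hq', hjump, hdx, hdx', hdv, hdv', hqdrift]
  rw [sub_eq_iff_eq_add] at hzdrift
  rw [hzdrift]
  congr 1
  field_simp
  ring

end
end

section
/- Let l_0 > 0, let g ∈ C([0, 2l_0]) ∩ C³((0, 2l_0]) satisfy g'(s) ≥ 0, g''(s) ≤ 0 and g'''(s) ≥ 0 for all s ∈ (0, 2l_0], and let c > 0. Define f(s) := c·s + ∫_0^s e^{−g(u)} du for s ∈ [0, 2l_0], and f(s) := f(2l_0) + f'(2l_0)·(s − 2l_0)/(1 + s − 2l_0) for s > 2l_0. Then for all real numbers δ, s with 0 ≤ δ ≤ s, one has f(s + δ) + f(s − δ) − 2 f(s) ≤ 0. -/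
open MeasureTheory Set

noncomputable section

/-- The concave function from the technical lemma: `f(s) = c·s + ∫₀^s e^{−g(u)} du` for
`s ∈ [0, 2l₀]`, extended by `f(2l₀) + f'(2l₀)·(s−2l₀)/(1+s−2l₀)` for `s > 2l₀`, where
`f'(2l₀) = c + e^{−g(2l₀)}`. -/
def fpiece (c l₀ : ℝ) (g : ℝ → ℝ) (s : ℝ) : ℝ :=
  if s ≤ 2 * l₀ then c * s + ∫ u in (0:ℝ)..s, Real.exp (-g u)
  else (c * (2 * l₀) + ∫ u in (0:ℝ)..(2 * l₀), Real.exp (-g u))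
    + (c + Real.exp (-g (2 * l₀))) * ((s - 2 * l₀) / (1 + s - 2 * l₀))


/-- An antitone integrand is a supergradient of its primitive. -/
theorem AntitoneOn.integral_le_add_mul {h : ℝ → ℝ} {L : ℝ} (hh : AntitoneOn h (Icc 0 L))
    {x y : ℝ} (hx : x ∈ Icc 0 L) (hy : y ∈ Icc 0 L) :
    ∫ u in (0:ℝ)..y, h u ≤ (∫ u in (0:ℝ)..x, h u) + h x * (y - x) := by
  have hint : ∀ a ∈ Icc 0 L, ∀ b ∈ Icc 0 L, IntervalIntegrable h volume a b := fun a ha b hb =>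
    (hh.mono (uIcc_subset_Icc ha hb)).intervalIntegrable
  have h0 : (0 : ℝ) ∈ Icc 0 L := ⟨le_rfl, hx.1.trans hx.2⟩
  have hconst : ∀ a b : ℝ, ∫ _ in a..b, h x = h x * (b - a) := fun a b => by
    rw [intervalIntegral.integral_const, smul_eq_mul, mul_comm]
  rcases le_total x y with hxy | hyx
  · rw [← intervalIntegral.integral_add_adjacent_intervals (hint 0 h0 x hx) (hint x hx y hy),
      ← hconst]
    gcongr
    exact intervalIntegral.integral_mono_on hxy (hint x hx y hy) intervalIntegrable_const
      fun u hu => hh hx ⟨hx.1.trans hu.1, hu.2.trans hy.2⟩ hu.1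
  · rw [← intervalIntegral.integral_add_adjacent_intervals (hint 0 h0 y hy) (hint y hy x hx)]
    have key : ∫ _ in y..x, h x ≤ ∫ u in y..x, h u :=
      intervalIntegral.integral_mono_on hyx intervalIntegrable_const (hint y hy x hx)
        fun u hu => hh ⟨hy.1.trans hu.1, hu.2.trans hx.2⟩ hx hu.2
    rw [hconst] at key
    linarith

/-- The tangent line inequality for the concave function `t ↦ t / (1 + t)`. -/
theorem div_one_add_le_tangent {t u : ℝ} (ht : 0 ≤ t) (hu : 0 ≤ u) :
    t / (1 + t) ≤ u / (1 + u) + (t - u) / (1 + u) ^ 2 := by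
  have key : u / (1 + u) + (t - u) / (1 + u) ^ 2 - t / (1 + t)
      = (t - u) ^ 2 / ((1 + t) * (1 + u) ^ 2) := by
    field_simp
    ring
  have : 0 ≤ (t - u) ^ 2 / ((1 + t) * (1 + u) ^ 2) := by positivity
  linarith

/-- If `e^{-g}` is antitone on `[0, 2l₀]`, then `fpiece` has a supergradient at every `x ≥ 0`. -/
theorem exists_supergradient_fpiece {l₀ c : ℝ} {g : ℝ → ℝ} (hl₀ : 0 < l₀) (hc : 0 < c)
    (hg : AntitoneOn (fun u => Real.exp (-g u)) (Icc 0 (2 * l₀))) {x : ℝ} (hx : 0 ≤ x) :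
    ∃ m : ℝ, ∀ y, 0 ≤ y → fpiece c l₀ g y ≤ fpiece c l₀ g x + m * (y - x) := by
  have hL : 2 * l₀ ∈ Icc 0 (2 * l₀) := ⟨by linarith, le_rfl⟩
  have hK : 0 < c + Real.exp (-g (2 * l₀)) := by positivity
  have htail : ∀ y, 1 + y - 2 * l₀ = 1 + (y - 2 * l₀) := fun y => by ring
  rcases le_or_gt x (2 * l₀) with hxL | hxL
  · refine ⟨c + Real.exp (-g x), fun y hy => ?_⟩
    rcases le_or_gt y (2 * l₀) with hyL | hyL
    · have := hg.integral_le_add_mul ⟨hx, hxL⟩ ⟨hy, hyL⟩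
      simp only [fpiece, if_pos hxL, if_pos hyL]
      linarith
    · have h₁ := hg.integral_le_add_mul ⟨hx, hxL⟩ hL
      have h₂ : Real.exp (-g (2 * l₀)) ≤ Real.exp (-g x) := hg ⟨hx, hxL⟩ hL hxL
      have h₃ := div_one_add_le_tangent (sub_nonneg.2 hyL.le) le_rfl
      norm_num at h₃
      have h₄ := mul_le_mul_of_nonneg_left h₃ hK.le
      have h₅ := mul_le_mul_of_nonneg_right h₂ (sub_nonneg.2 hyL.le)
      simp only [fpiece, if_pos hxL, if_neg hyL.not_ge, htail]
      linarith
  · set K := c + Real.exp (-g (2 * l₀)) with hKdef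
    have hu : 0 ≤ x - 2 * l₀ := sub_nonneg.2 hxL.le
    refine ⟨K / (1 + (x - 2 * l₀)) ^ 2, fun y hy => ?_⟩
    rcases le_or_gt y (2 * l₀) with hyL | hyL
    · have h₁ := hg.integral_le_add_mul hL ⟨hy, hyL⟩
      have h₂ : K / (1 + (x - 2 * l₀)) ^ 2 ≤ K :=
        div_le_self hK.le (one_le_pow₀ (by linarith))
      have h₃ := mul_le_mul_of_nonneg_left (div_one_add_le_tangent le_rfl hu) hK.le
      have h₄ := mul_le_mul_of_nonneg_right h₂ (sub_nonneg.2 hyL)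
      have h₅ : K * ((0 - (x - 2 * l₀)) / (1 + (x - 2 * l₀)) ^ 2)
          = K / (1 + (x - 2 * l₀)) ^ 2 * (0 - (x - 2 * l₀)) := by ring
      rw [mul_add, h₅, zero_div, mul_zero] at h₃
      simp only [fpiece, if_pos hyL, if_neg hxL.not_ge, htail, ← hKdef]
      have h₆ : K * (y - 2 * l₀) = c * (y - 2 * l₀) + Real.exp (-g (2 * l₀)) * (y - 2 * l₀) := by
        rw [hKdef, add_mul]
      linarith
    · have h₃ := mul_le_mul_of_nonneg_left
        (div_one_add_le_tangent (sub_nonneg.2 hyL.le) hu) hK.le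
      have h₅ : K * ((y - 2 * l₀ - (x - 2 * l₀)) / (1 + (x - 2 * l₀)) ^ 2)
          = K / (1 + (x - 2 * l₀)) ^ 2 * (y - x) := by ring
      rw [mul_add, h₅] at h₃
      simp only [fpiece, if_neg hyL.not_ge, if_neg hxL.not_ge, htail, ← hKdef]
      linarith

/-- for all `0 ≤ δ ≤ s`, `f(s+δ) + f(s−δ) − 2f(s) ≤ 0`. -/
theorem stmt8 (l₀ : ℝ) (hl₀ : 0 < l₀) (c : ℝ) (hc : 0 < c) (g : ℝ → ℝ)
    (hgcont : ContinuousOn g (Set.Icc 0 (2 * l₀)))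
    (hg3 : ContDiffOn ℝ 3 g (Set.Ioc 0 (2 * l₀)))
    (hg1 : ∀ s ∈ Set.Ioc (0 : ℝ) (2 * l₀),
      0 ≤ derivWithin g (Set.Ioc 0 (2 * l₀)) s)
    (hg2 : ∀ s ∈ Set.Ioc (0 : ℝ) (2 * l₀),
      derivWithin (derivWithin g (Set.Ioc 0 (2 * l₀))) (Set.Ioc 0 (2 * l₀)) s ≤ 0)
    (hg3' : ∀ s ∈ Set.Ioc (0 : ℝ) (2 * l₀),
      0 ≤ derivWithin (derivWithin (derivWithin g (Set.Ioc 0 (2 * l₀)))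
        (Set.Ioc 0 (2 * l₀))) (Set.Ioc 0 (2 * l₀)) s) :
    ∀ δ s : ℝ, 0 ≤ δ → δ ≤ s →
      fpiece c l₀ g (s + δ) + fpiece c l₀ g (s - δ) - 2 * fpiece c l₀ g s ≤ 0 := by
  intro δ s hδ hδs
  have hnhds : ∀ x ∈ Ioo 0 (2 * l₀), Ioc 0 (2 * l₀) ∈ nhds x := fun x hx =>
    Filter.mem_of_superset (Ioo_mem_nhds hx.1 hx.2) Ioo_subset_Ioc_self
  have hmono : MonotoneOn g (Icc 0 (2 * l₀)) := by
    refine monotoneOn_of_deriv_nonneg (convex_Icc _ _) hgcont ?_ ?_ <;> rw [interior_Icc]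
    · exact (hg3.differentiableOn (by norm_num)).mono Ioo_subset_Ioc_self
    · intro x hx
      rw [← derivWithin_of_mem_nhds (hnhds x hx)]
      exact hg1 x (Ioo_subset_Ioc_self hx)
  have hanti : AntitoneOn (fun u => Real.exp (-g u)) (Icc 0 (2 * l₀)) := fun x hx y hy hxy =>
    Real.exp_le_exp.2 (neg_le_neg (hmono hx hy hxy))
  obtain ⟨m, hm⟩ := exists_supergradient_fpiece hl₀ hc hanti (hδ.trans hδs)
  have h₁ := hm (s + δ) (by linarith)
  have h₂ := hm (s - δ) (by linarith)
  linarith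

end
end

section
/- Let l_0 > 0, let g ∈ C([0, 2l_0]) ∩ C³((0, 2l_0]) satisfy g'(s) ≥ 0, g''(s) ≤ 0 and g'''(s) ≥ 0 for all s ∈ (0, 2l_0], and let c > 0. Define f(s) := c·s + ∫_0^s e^{−g(u)} du for s ∈ [0, 2l_0], and f(s) := f(2l_0) + f'(2l_0)·(s − 2l_0)/(1 + s − 2l_0) for s > 2l_0. Then for all real numbers δ, s with 0 ≤ δ ≤ s ≤ l_0, one has f(s + δ) + f(s − δ) − 2 f(s) ≤ f''(s)·δ². -/
open MeasureTheory Set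

noncomputable section

/-- If the second derivative `F₂` of `F` is concave on `(0, 2s)`, the symmetric second difference
of `F` at `s` is at most `F₂ s * δ ^ 2`. -/
theorem second_difference_le_of_concaveOn {F F₁ F₂ : ℝ → ℝ} {s δ : ℝ} (hs : 0 < s)
    (hF : ContinuousOn F (Icc 0 (2 * s)))
    (h₁ : ∀ x ∈ Ioo 0 (2 * s), HasDerivAt F (F₁ x) x)
    (h₂ : ∀ x ∈ Ioo 0 (2 * s), HasDerivAt F₁ (F₂ x) x)
    (hconc : ConcaveOn ℝ (Ioo 0 (2 * s)) F₂) (hδ₀ : 0 ≤ δ) (hδ : δ ≤ s) :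
    F (s + δ) + F (s - δ) - 2 * F s ≤ F₂ s * δ ^ 2 := by
  have hplus : ∀ t ∈ Ico 0 s, s + t ∈ Ioo 0 (2 * s) := fun t ht =>
    ⟨by linarith [ht.1], by linarith [ht.2]⟩
  have hminus : ∀ t ∈ Ico 0 s, s - t ∈ Ioo 0 (2 * s) := fun t ht =>
    ⟨by linarith [ht.2], by linarith [ht.1]⟩
  have hφ' : ∀ t ∈ Ico 0 s, HasDerivAt (fun t => F₁ (s + t) - F₁ (s - t) - 2 * F₂ s * t)
      (F₂ (s + t) + F₂ (s - t) - 2 * F₂ s) t := by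
    intro t ht
    have hp := (h₂ _ (hplus t ht)).comp_const_add s t
    have hm := (h₂ _ (hminus t ht)).comp_const_sub s t
    refine HasDerivAt.congr_deriv ((hp.sub hm).sub ((hasDerivAt_id t).const_mul (2 * F₂ s))) ?_
    ring
  have hφ : ∀ t ∈ Ico 0 s, HasDerivAt (fun t => F (s + t) + F (s - t) - 2 * F s - F₂ s * t ^ 2)
      (F₁ (s + t) - F₁ (s - t) - 2 * F₂ s * t) t := by
    intro t ht
    have hp := (h₁ _ (hplus t ht)).comp_const_add s t
    have hm := (h₁ _ (hminus t ht)).comp_const_sub s t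
    refine HasDerivAt.congr_deriv (((hp.add hm).sub_const (2 * F s)).sub
      ((hasDerivAt_pow 2 t).const_mul (F₂ s))) ?_
    push_cast
    ring
  have hmid : ∀ t ∈ Ico 0 s, F₂ (s + t) + F₂ (s - t) - 2 * F₂ s ≤ 0 := by
    intro t ht
    have h := hconc.2 (hplus t ht) (hminus t ht) (by norm_num : (0 : ℝ) ≤ 1 / 2)
      (by norm_num : (0 : ℝ) ≤ 1 / 2) (by norm_num)
    simp only [smul_eq_mul] at h
    rw [show 1 / 2 * (s + t) + 1 / 2 * (s - t) = s by ring] at h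
    linarith
  have hanti' : AntitoneOn (fun t => F₁ (s + t) - F₁ (s - t) - 2 * F₂ s * t) (Ico 0 s) :=
    antitoneOn_of_hasDerivWithinAt_nonpos (convex_Ico 0 s)
      (fun t ht => (hφ' t ht).continuousAt.continuousWithinAt)
      (fun t ht => (hφ' t (interior_subset ht)).hasDerivWithinAt)
      (fun t ht => hmid t (interior_subset ht))
  have hcont : ContinuousOn (fun t => F (s + t) + F (s - t) - 2 * F s - F₂ s * t ^ 2)
      (Icc 0 s) := by
    have hp : ContinuousOn (fun t => F (s + t)) (Icc 0 s) :=
      hF.comp (by fun_prop) fun t ht => ⟨by linarith [ht.1], by linarith [ht.2]⟩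
    have hm : ContinuousOn (fun t => F (s - t)) (Icc 0 s) :=
      hF.comp (by fun_prop) fun t ht => ⟨by linarith [ht.2], by linarith [ht.1]⟩
    exact ((hp.add hm).sub continuousOn_const).sub (by fun_prop)
  have hanti : AntitoneOn (fun t => F (s + t) + F (s - t) - 2 * F s - F₂ s * t ^ 2)
      (Icc 0 s) := by
    refine antitoneOn_of_hasDerivWithinAt_nonpos (convex_Icc 0 s) hcont
      (f' := fun t => F₁ (s + t) - F₁ (s - t) - 2 * F₂ s * t) ?_ ?_
    · intro t ht
      rw [interior_Icc] at ht
      exact (hφ t (Ioo_subset_Ico_self ht)).hasDerivWithinAt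
    · intro t ht
      rw [interior_Icc] at ht
      simpa using hanti' (left_mem_Ico.2 hs) (Ioo_subset_Ico_self ht) ht.1.le
  have h := hanti (left_mem_Icc.2 hs.le) ⟨hδ₀, hδ⟩ hδ₀
  simp only [add_zero, sub_zero] at h
  linarith

/-- The derivative of `exp (-g)` is concave when the first three derivatives of `g` are
nonnegative, nonpositive and nonnegative, respectively. -/
theorem concaveOn_deriv_exp_neg {g g₁ g₂ g₃ : ℝ → ℝ} {a b : ℝ}
    (h₁ : ∀ x ∈ Ioo a b, HasDerivAt g (g₁ x) x)
    (h₂ : ∀ x ∈ Ioo a b, HasDerivAt g₁ (g₂ x) x)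
    (h₃ : ∀ x ∈ Ioo a b, HasDerivAt g₂ (g₃ x) x)
    (hg₁ : ∀ x ∈ Ioo a b, 0 ≤ g₁ x) (hg₂ : ∀ x ∈ Ioo a b, g₂ x ≤ 0)
    (hg₃ : ∀ x ∈ Ioo a b, 0 ≤ g₃ x) :
    ConcaveOn ℝ (Ioo a b) (fun x => Real.exp (-g x) * -g₁ x) := by
  have hd : ∀ x ∈ Ioo a b, HasDerivAt (fun x => Real.exp (-g x) * -g₁ x)
      (Real.exp (-g x) * (g₁ x ^ 2 - g₂ x)) x := by
    intro x hx
    refine HasDerivAt.congr_deriv ((h₁ x hx).neg.exp.mul (h₂ x hx).neg) ?_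
    simp only [Pi.neg_apply]
    ring
  have hdd : ∀ x ∈ Ioo a b, HasDerivAt (fun x => Real.exp (-g x) * (g₁ x ^ 2 - g₂ x))
      (Real.exp (-g x) * (3 * (g₁ x * g₂ x) - g₁ x ^ 3 - g₃ x)) x := by
    intro x hx
    refine HasDerivAt.congr_deriv ((h₁ x hx).neg.exp.mul (((h₂ x hx).pow 2).sub (h₃ x hx))) ?_
    simp only [Pi.neg_apply]
    push_cast
    ring
  refine concaveOn_of_hasDerivWithinAt2_nonpos (convex_Ioo a b)
    (fun x hx => (hd x hx).continuousAt.continuousWithinAt)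
    (fun x hx => (hd x (interior_subset hx)).hasDerivWithinAt)
    (fun x hx => (hdd x (interior_subset hx)).hasDerivWithinAt) fun x hx => ?_
  have hx := interior_subset hx
  have hprod := mul_nonpos_of_nonneg_of_nonpos (hg₁ x hx) (hg₂ x hx)
  have hcube := pow_nonneg (hg₁ x hx) 3
  exact mul_nonpos_of_nonneg_of_nonpos (Real.exp_pos _).le (by linarith [hg₃ x hx])

theorem continuousOn_fpiece {c l₀ : ℝ} {g : ℝ → ℝ} (hl₀ : 0 < l₀)
    (hg : ContinuousOn g (Icc 0 (2 * l₀))) :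
    ContinuousOn (fpiece c l₀ g) (Icc 0 (2 * l₀)) := by
  have hint : ContinuousOn (fun s => ∫ u in (0:ℝ)..s, Real.exp (-g u)) (Icc 0 (2 * l₀)) := by
    have h := intervalIntegral.continuousOn_primitive_interval (μ := volume) (a := 0) (b := 2 * l₀)
      (f := fun u => Real.exp (-g u))
      (by rw [uIcc_of_le (by linarith)]; exact hg.neg.rexp.integrableOn_Icc)
    rwa [uIcc_of_le (by linarith)] at h
  have hsum : ContinuousOn (fun s => c * s + ∫ u in (0:ℝ)..s, Real.exp (-g u))
      (Icc 0 (2 * l₀)) := by fun_prop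
  exact hsum.congr fun x hx => if_pos hx.2

theorem hasDerivAt_fpiece {c l₀ : ℝ} {g : ℝ → ℝ} (hg : ContinuousOn g (Icc 0 (2 * l₀)))
    {x : ℝ} (hx : x ∈ Ioo 0 (2 * l₀)) :
    HasDerivAt (fpiece c l₀ g) (c + Real.exp (-g x)) x := by
  have hexp : ContinuousOn (fun u => Real.exp (-g u)) (Icc 0 (2 * l₀)) := hg.neg.rexp
  have hint : HasDerivAt (fun s => ∫ u in (0:ℝ)..s, Real.exp (-g u)) (Real.exp (-g x)) x := by
    refine intervalIntegral.integral_hasDerivAt_right ?_ ?_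
      (hexp.continuousAt (Icc_mem_nhds hx.1 hx.2))
    · refine ContinuousOn.intervalIntegrable (hexp.mono ?_)
      rw [uIcc_of_le hx.1.le]
      exact Icc_subset_Icc_right hx.2.le
    · exact (hexp.mono Ioo_subset_Icc_self).stronglyMeasurableAtFilter isOpen_Ioo x hx
  have h := ((hasDerivAt_id x).const_mul c).add hint
  rw [mul_one] at h
  refine h.congr_of_eventuallyEq ?_
  filter_upwards [Iio_mem_nhds hx.2] with y hy
  exact if_pos hy.le

/-- for all `0 ≤ δ ≤ s ≤ l₀`,
`f(s+δ) + f(s−δ) − 2f(s) ≤ f''(s)·δ²`. -/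
theorem stmt9 (l₀ : ℝ) (hl₀ : 0 < l₀) (c : ℝ) (hc : 0 < c) (g : ℝ → ℝ)
    (hgcont : ContinuousOn g (Set.Icc 0 (2 * l₀)))
    (hg3 : ContDiffOn ℝ 3 g (Set.Ioc 0 (2 * l₀)))
    (hg1 : ∀ s ∈ Set.Ioc (0 : ℝ) (2 * l₀),
      0 ≤ derivWithin g (Set.Ioc 0 (2 * l₀)) s)
    (hg2 : ∀ s ∈ Set.Ioc (0 : ℝ) (2 * l₀),
      derivWithin (derivWithin g (Set.Ioc 0 (2 * l₀))) (Set.Ioc 0 (2 * l₀)) s ≤ 0)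
    (hg3' : ∀ s ∈ Set.Ioc (0 : ℝ) (2 * l₀),
      0 ≤ derivWithin (derivWithin (derivWithin g (Set.Ioc 0 (2 * l₀)))
        (Set.Ioc 0 (2 * l₀))) (Set.Ioc 0 (2 * l₀)) s) :
    ∀ δ s : ℝ, 0 ≤ δ → δ ≤ s → s ≤ l₀ →
      fpiece c l₀ g (s + δ) + fpiece c l₀ g (s - δ) - 2 * fpiece c l₀ g s ≤
        deriv (deriv (fpiece c l₀ g)) s * δ ^ 2 := by
  intro δ s hδ₀ hδs hsl
  rcases hδ₀.eq_or_lt with rfl | hδ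
  · simp only [add_zero, sub_zero]
    linarith
  have hs : 0 < s := hδ.trans_le hδs
  have hU : UniqueDiffOn ℝ (Ioc 0 (2 * l₀)) := uniqueDiffOn_Ioc 0 (2 * l₀)
  have hat : ∀ {k : ℝ → ℝ}, DifferentiableOn ℝ k (Ioc 0 (2 * l₀)) → ∀ x ∈ Ioo 0 (2 * l₀),
      HasDerivAt k (derivWithin k (Ioc 0 (2 * l₀)) x) x := fun hk x hx =>
    (hk x (Ioo_subset_Ioc_self hx)).hasDerivWithinAt.hasDerivAt (Ioc_mem_nhds hx.1 hx.2)
  have hC2 : ContDiffOn ℝ 2 (derivWithin g (Ioc 0 (2 * l₀))) (Ioc 0 (2 * l₀)) :=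
    hg3.derivWithin hU (by norm_num)
  have hC1 : ContDiffOn ℝ 1 (derivWithin (derivWithin g (Ioc 0 (2 * l₀))) (Ioc 0 (2 * l₀)))
      (Ioc 0 (2 * l₀)) := hC2.derivWithin hU (by norm_num)
  have hd₁ := hat (hg3.differentiableOn (by norm_num))
  have hd₂ := hat (hC2.differentiableOn (by norm_num))
  have hd₃ := hat (hC1.differentiableOn (by norm_num))
  have hconc := concaveOn_deriv_exp_neg hd₁ hd₂ hd₃
    (fun x hx => hg1 x (Ioo_subset_Ioc_self hx)) (fun x hx => hg2 x (Ioo_subset_Ioc_self hx))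
    (fun x hx => hg3' x (Ioo_subset_Ioc_self hx))
  have hF₁ : ∀ x ∈ Ioo 0 (2 * l₀), HasDerivAt (fun x => c + Real.exp (-g x))
      (Real.exp (-g x) * -derivWithin g (Ioc 0 (2 * l₀)) x) x := fun x hx =>
    (hd₁ x hx).neg.exp.const_add c
  have hs_mem : s ∈ Ioo 0 (2 * l₀) := ⟨hs, by linarith⟩
  have hderiv : deriv (deriv (fpiece c l₀ g)) s =
      Real.exp (-g s) * -derivWithin g (Ioc 0 (2 * l₀)) s := by
    refine ((hF₁ s hs_mem).congr_of_eventuallyEq ?_).deriv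
    filter_upwards [Ioo_mem_nhds hs_mem.1 hs_mem.2] with y hy
    exact (hasDerivAt_fpiece hgcont hy).deriv
  have hsub : Ioo 0 (2 * s) ⊆ Ioo 0 (2 * l₀) := Ioo_subset_Ioo_right (by linarith)
  rw [hderiv]
  exact second_difference_le_of_concaveOn hs
    ((continuousOn_fpiece hl₀ hgcont).mono (Icc_subset_Icc_right (by linarith)))
    (fun x hx => hasDerivAt_fpiece hgcont (hsub hx)) (fun x hx => hF₁ x (hsub hx))
    (hconc.subset hsub (convex_Ioo 0 (2 * s))) hδ₀ hδs

end
end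

section
/- Let a ≥ 0, b > 0, θ ∈ (0,1], and let ν be a nonnegative Borel measure on ℝ^d with ν({0}) = 0 and ∫_{ℝ^d} (|u|² ∧ |u|^θ) ν(du) < ∞. Let U : ℝ^{2d} → ℝ^d, and suppose there exist a nonnegative C¹ function 𝒱_0 : ℝ^d → ℝ, constants r_0 ∈ ℝ and r > 0 with |r_0| < r, c > 0 and C ≥ 0 such that for all x, v ∈ ℝ^d: ⟨r²x + r_0 v + ∇𝒱_0(x), ax + bv⟩ + ⟨v + r_0 x, U(x,v)⟩ ≤ −c(𝒱_0(x) + |x|² + |v|²) + C. Define 𝒱(x,v) := 1 + 𝒱_0(x) + (r²/2)|x|² + (1/2)|v|² + r_0⟨x,v⟩ and 𝒲(x,v) := 1 + 𝒱(x,v)^{θ/2}. Then 𝒲 : ℝ^{2d} → [1,∞), 𝒲(x,v) → ∞ as |x| + |v| → ∞, and there exist constants c_0, C_0 > 0 such that for all x, v ∈ ℝ^d: (𝓛𝒲)(x,v) ≤ −c_0 𝒲(x,v) + C_0, where (𝓛𝒲)(x,v) := ⟨ax + bv, ∇_x 𝒲(x,v)⟩ + ⟨U(x,v), ∇_v 𝒲(x,v)⟩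 + ∫_{ℝ^d} ( 𝒲(x, v+u) − 𝒲(x,v) − ⟨∇_v 𝒲(x,v), u⟩ 1_{{|u| ≤ 1}} ) ν(du). -/
open MeasureTheory Set Filter
open scoped ENNReal RealInnerProductSpace

section LyapunovEnergy

variable {E : Type*} [NormedAddCommGroup E] [InnerProductSpace ℝ E]

/-- Coercivity of the quadratic form `(r²/2)|x|² + (1/2)|v|² + r₀⟨x,v⟩`. -/
lemma quadratic_form_coercive {r₀ r : ℝ} (hr : 0 < r) (x v : E) :
    (1 - |r₀| / r) / 2 * (r ^ 2 * ‖x‖ ^ 2 + ‖v‖ ^ 2) ≤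
      (r ^ 2 / 2) * ‖x‖ ^ 2 + (1 / 2) * ‖v‖ ^ 2 + r₀ * ⟪x, v⟫ := by
  have hcs : |r₀ * ⟪x, v⟫| ≤ |r₀| / r * (r * ‖x‖ * ‖v‖) := by
    rw [abs_mul]
    calc |r₀| * |⟪x, v⟫| ≤ |r₀| * (‖x‖ * ‖v‖) := by
          gcongr
          exact abs_real_inner_le_norm x v
      _ = |r₀| / r * (r * ‖x‖ * ‖v‖) := by field_simp
  have hamgm : |r₀| / r * (r * ‖x‖ * ‖v‖) ≤ |r₀| / r * ((r ^ 2 * ‖x‖ ^ 2 + ‖v‖ ^ 2) / 2) := by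
    gcongr
    nlinarith [sq_nonneg (r * ‖x‖ - ‖v‖)]
  linarith [neg_abs_le (r₀ * ⟪x, v⟫)]

/-- Upper bound for the quadratic form `(r²/2)|x|² + (1/2)|v|² + r₀⟨x,v⟩`. -/
lemma quadratic_form_le {r₀ r : ℝ} (hr₀r : |r₀| ≤ r) (x v : E) :
    (r ^ 2 / 2) * ‖x‖ ^ 2 + (1 / 2) * ‖v‖ ^ 2 + r₀ * ⟪x, v⟫ ≤
      (1 + r ^ 2) * (‖x‖ ^ 2 + ‖v‖ ^ 2) := by
  have hcs : r₀ * ⟪x, v⟫ ≤ r * (‖x‖ * ‖v‖) := by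
    refine (le_abs_self _).trans ?_
    rw [abs_mul]
    exact mul_le_mul hr₀r (abs_real_inner_le_norm x v) (abs_nonneg _)
      ((abs_nonneg _).trans hr₀r)
  nlinarith [sq_nonneg (r * ‖x‖ - ‖v‖), sq_nonneg ‖x‖, sq_nonneg ‖v‖, sq_nonneg (r * ‖v‖),
    sq_nonneg (r * ‖x‖)]

lemma norm_add_smul_sq_le {r₀ r : ℝ} (hr₀r : |r₀| ≤ r) (x v : E) :
    ‖v + r₀ • x‖ ^ 2 ≤ 2 * (r ^ 2 * ‖x‖ ^ 2 + ‖v‖ ^ 2) := by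
  have hn : ‖v + r₀ • x‖ ≤ ‖v‖ + r * ‖x‖ := by
    refine (norm_add_le _ _).trans ?_
    rw [norm_smul, Real.norm_eq_abs]
    gcongr
  calc ‖v + r₀ • x‖ ^ 2 ≤ (‖v‖ + r * ‖x‖) ^ 2 := by gcongr
    _ ≤ 2 * (r ^ 2 * ‖x‖ ^ 2 + ‖v‖ ^ 2) := by nlinarith [sq_nonneg (‖v‖ - r * ‖x‖)]

/-- The tangent line inequality for the concave function `t ↦ t ^ p`, `0 ≤ p ≤ 1`. -/
lemma rpow_add_le_tangent {t h p : ℝ} (ht : 0 < t) (hth : 0 ≤ t + h) (hp0 : 0 ≤ p)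
    (hp1 : p ≤ 1) : (t + h) ^ p ≤ t ^ p + p * t ^ (p - 1) * h := by
  have hs : -1 ≤ h / t := by rw [le_div_iff₀ ht]; linarith
  have hb := rpow_one_add_le_one_add_mul_self hs hp0 hp1
  have hsplit : t + h = t * (1 + h / t) := by field_simp
  rw [hsplit, Real.mul_rpow ht.le (by linarith), Real.rpow_sub_one ht.ne']
  calc t ^ p * (1 + h / t) ^ p ≤ t ^ p * (1 + p * (h / t)) := by gcongr
    _ = t ^ p + p * (t ^ p / t) * h := by field_simp

lemma rpow_sub_one_le_one {t p : ℝ} (ht : 1 ≤ t) (hp : p ≤ 1) : t ^ (p - 1) ≤ 1 :=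
  Real.rpow_le_one_of_one_le_of_nonpos ht (by linarith)

/-- Growth of `t ^ (θ / 2)` under an increment of square-root type. -/
lemma rpow_half_le_add {t s B n θ : ℝ} (ht : 0 ≤ t) (hs : 0 ≤ s) (hB : 0 ≤ B) (hn : 0 ≤ n)
    (hθ0 : 0 ≤ θ) (hθ1 : θ ≤ 1) (hst : s ≤ (√t + B * n) ^ 2) :
    s ^ (θ / 2) ≤ t ^ (θ / 2) + B ^ θ * n ^ θ := by
  have hpos : 0 ≤ √t + B * n := by positivity
  calc s ^ (θ / 2) ≤ ((√t + B * n) ^ 2) ^ (θ / 2) := by gcongr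
    _ = (√t + B * n) ^ θ := by
      rw [← Real.rpow_natCast, ← Real.rpow_mul hpos]
      congr 1
      push_cast
      ring
    _ ≤ (√t) ^ θ + (B * n) ^ θ :=
      Real.rpow_add_le_add_rpow (Real.sqrt_nonneg t) (by positivity) hθ0 hθ1
    _ = t ^ (θ / 2) + B ^ θ * n ^ θ := by
      rw [Real.mul_rpow hB hn, Real.sqrt_eq_rpow, ← Real.rpow_mul ht]
      congr 2
      ring

lemma hasFDerivAt_energy_velocity (V₀ : E → ℝ) (r₀ r : ℝ) (x v : E) :
    HasFDerivAt (fun w => 1 + V₀ x + (r ^ 2 / 2) * ‖x‖ ^ 2 + (1 / 2) * ‖w‖ ^ 2 + r₀ * ⟪x, w⟫)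
      (innerSL ℝ (v + r₀ • x)) v := by
  have hsq : HasFDerivAt (fun w : E => ‖w‖ ^ 2) (2 • innerSL ℝ v) v :=
    (hasStrictFDerivAt_norm_sq v).hasFDerivAt
  have hin : HasFDerivAt (fun w : E => ⟪x, w⟫) (innerSL ℝ x) v := (innerSL ℝ x).hasFDerivAt
  refine (((hsq.const_mul (1 / 2)).const_add
    (1 + V₀ x + (r ^ 2 / 2) * ‖x‖ ^ 2)).add (hin.const_mul r₀)).congr_fderiv ?_
  ext u
  simp

lemma hasFDerivAt_energy_position [CompleteSpace E] {V₀ : E → ℝ} {x : E}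
    (hV₀ : DifferentiableAt ℝ V₀ x) (r₀ r : ℝ) (v : E) :
    HasFDerivAt (fun y => 1 + V₀ y + (r ^ 2 / 2) * ‖y‖ ^ 2 + (1 / 2) * ‖v‖ ^ 2 + r₀ * ⟪y, v⟫)
      (innerSL ℝ ((r ^ 2) • x + r₀ • v + gradient V₀ x)) x := by
  have hsq : HasFDerivAt (fun w : E => ‖w‖ ^ 2) (2 • innerSL ℝ x) x :=
    (hasStrictFDerivAt_norm_sq x).hasFDerivAt
  have hin : HasFDerivAt (fun w : E => ⟪w, v⟫) (innerSL ℝ v) x := by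
    simp_rw [real_inner_comm v]
    exact (innerSL ℝ v).hasFDerivAt
  have hgrad := hV₀.hasGradientAt.hasFDerivAt
  refine ((((hgrad.const_add 1).add (hsq.const_mul (r ^ 2 / 2))).add_const
    ((1 / 2) * ‖v‖ ^ 2)).add (hin.const_mul r₀)).congr_fderiv ?_
  ext u
  simp
  ring

lemma fderiv_one_add_rpow {f : E → ℝ} {y v : E} {p : ℝ} (hf : HasFDerivAt f (innerSL ℝ y) v)
    (hpos : 0 < f v) (u : E) :
    fderiv ℝ (fun w => 1 + f w ^ p) v u = p * f v ^ (p - 1) * ⟪y, u⟫ := by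
  rw [((hf.rpow_const (p := p) (Or.inl hpos.ne')).const_add 1).fderiv]
  simp

/-- The Lévy jump term of `1 + f ^ (θ / 2)` is dominated by the moment function of the measure. -/
lemma jump_le {f₀ f₁ h θ κ : ℝ} {y u : E} (hθ0 : 0 < θ) (hθ1 : θ ≤ 1) (hκ : 0 < κ)
    (hf₀ : 1 ≤ f₀) (hf₁ : 1 ≤ f₁) (hy : κ * ‖y‖ ^ 2 ≤ f₀)
    (hf : f₁ = f₀ + ⟪y, u⟫ + (1 / 2) * ‖u‖ ^ 2)
    (hh : h = θ / 2 * f₀ ^ (θ / 2 - 1) * ⟪y, u⟫) :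
    f₁ ^ (θ / 2) - f₀ ^ (θ / 2) - (if ‖u‖ ≤ 1 then h else 0) ≤
      (1 + (1 + 1 / √κ) ^ θ) * min (‖u‖ ^ 2) (‖u‖ ^ θ) := by
  have hM : 0 ≤ (1 + 1 / √κ) ^ θ := by positivity
  split_ifs with hu
  · have hmin : min (‖u‖ ^ 2) (‖u‖ ^ θ) = ‖u‖ ^ 2 := by
      refine min_eq_left ?_
      rcases (norm_nonneg u).eq_or_lt with h0 | h0
      · rw [← h0, Real.zero_rpow hθ0.ne']; simp
      · rw [← Real.rpow_natCast]
        exact Real.rpow_le_rpow_of_exponent_ge h0 hu (by push_cast; linarith)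
    have htan := rpow_add_le_tangent (t := f₀) (h := ⟪y, u⟫ + (1 / 2) * ‖u‖ ^ 2) (p := θ / 2)
      (by linarith) (by linarith) (by linarith) (by linarith)
    rw [← add_assoc, ← hf] at htan
    have hle : θ / 2 * f₀ ^ (θ / 2 - 1) ≤ 1 :=
      mul_le_one₀ (by linarith) (by positivity) (rpow_sub_one_le_one hf₀ (by linarith))
    rw [hmin, hh]
    nlinarith [mul_le_mul_of_nonneg_right hle (sq_nonneg ‖u‖), mul_nonneg hM (sq_nonneg ‖u‖)]
  · push Not at hu
    have hmin : min (‖u‖ ^ 2) (‖u‖ ^ θ) = ‖u‖ ^ θ := by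
      refine min_eq_right ?_
      rw [← Real.rpow_natCast]
      exact Real.rpow_le_rpow_of_exponent_le hu.le (by push_cast; linarith)
    have hyn : ‖y‖ ≤ 1 / √κ * √f₀ := by
      have hsq : √κ * ‖y‖ ≤ √f₀ := by
        refine Real.le_sqrt_of_sq_le ?_
        rw [mul_pow, Real.sq_sqrt hκ.le]
        exact hy
      rw [one_div, inv_mul_eq_div, le_div_iff₀ (Real.sqrt_pos.2 hκ)]
      linarith
    have hgrow : f₁ ≤ (√f₀ + (1 + 1 / √κ) * ‖u‖) ^ 2 := by
      have hin : ⟪y, u⟫ ≤ 1 / √κ * √f₀ * ‖u‖ :=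
        (real_inner_le_norm y u).trans (by gcongr)
      have hs := Real.sq_sqrt (zero_le_one.trans hf₀)
      have hA : 0 ≤ 1 / √κ := by positivity
      have h1 : 0 ≤ 1 / √κ * √f₀ * ‖u‖ := by positivity
      have h2 : 0 ≤ √f₀ * ‖u‖ := by positivity
      have h3 : 0 ≤ 1 / √κ * ‖u‖ ^ 2 := by positivity
      nlinarith [sq_nonneg (1 / √κ * ‖u‖), sq_nonneg ‖u‖]
    have hrpow := rpow_half_le_add (zero_le_one.trans hf₀) (zero_le_one.trans hf₁)
      (by positivity) (norm_nonneg u) hθ0.le hθ1 hgrow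
    have hnn : 0 ≤ ‖u‖ ^ θ := by positivity
    rw [hmin]
    linarith

end LyapunovEnergy

/-- Upper bound for a Bochner integral by a pointwise upper bound, without integrability of the
integrand. -/
lemma integral_le_of_le_of_integral_nonneg {α : Type*} [MeasurableSpace α] {μ : Measure α}
    {f g : α → ℝ} (hg : Integrable g μ) (hg0 : 0 ≤ ∫ u, g u ∂μ) (hfg : ∀ u, f u ≤ g u) :
    ∫ u, f u ∂μ ≤ ∫ u, g u ∂μ := by
  by_cases hf : Integrable f μ
  · exact integral_mono hf hg hfg
  · rwa [integral_undef hf]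

/-- the Lyapunov condition. Under the drift condition
`⟨r²x + r₀v + ∇𝒱₀(x), ax + bv⟩ + ⟨v + r₀x, U(x,v)⟩ ≤ −c(𝒱₀(x)+|x|²+|v|²) + C` and the moment
condition `∫ (|u|² ∧ |u|^θ) ν(du) < ∞`, the function `𝒲 = 1 + 𝒱^{θ/2}` with
`𝒱(x,v) = 1 + 𝒱₀(x) + (r²/2)|x|² + (1/2)|v|² + r₀⟨x,v⟩` takes values in `[1,∞)`, tends to `∞`
at infinity, and satisfies `(𝓛𝒲)(x,v) ≤ −c₀𝒲(x,v) + C₀` for some `c₀, C₀ > 0`. -/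
theorem stmt10 (d : ℕ) (a b θ : ℝ) (ha : 0 ≤ a) (hb : 0 < b)
    (hθ : θ ∈ Set.Ioc (0 : ℝ) 1)
    (ν : Measure (EuclideanSpace ℝ (Fin d))) (hν0 : ν {0} = 0)
    (hν : ∫⁻ u, ENNReal.ofReal (min (‖u‖ ^ 2) (‖u‖ ^ θ)) ∂ν < ∞)
    (U : EuclideanSpace ℝ (Fin d) × EuclideanSpace ℝ (Fin d) → EuclideanSpace ℝ (Fin d))
    (V₀ : EuclideanSpace ℝ (Fin d) → ℝ) (hV₀smooth : ContDiff ℝ 1 V₀)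
    (hV₀nn : ∀ x, 0 ≤ V₀ x)
    (r₀ r c C : ℝ) (hr₀r : |r₀| < r) (hr : 0 < r) (hc : 0 < c) (hC : 0 ≤ C)
    (hdrift : ∀ x v : EuclideanSpace ℝ (Fin d),
      ⟪(r ^ 2) • x + r₀ • v + gradient V₀ x, a • x + b • v⟫ + ⟪v + r₀ • x, U (x, v)⟫ ≤
        -c * (V₀ x + ‖x‖ ^ 2 + ‖v‖ ^ 2) + C)
    (V W : EuclideanSpace ℝ (Fin d) → EuclideanSpace ℝ (Fin d) → ℝ)
    (hVdef : ∀ x v, V x v =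
      1 + V₀ x + (r ^ 2 / 2) * ‖x‖ ^ 2 + (1 / 2) * ‖v‖ ^ 2 + r₀ * ⟪x, v⟫)
    (hWdef : ∀ x v, W x v = 1 + V x v ^ (θ / 2)) :
    (∀ x v : EuclideanSpace ℝ (Fin d), 1 ≤ W x v) ∧
      Tendsto (fun p : EuclideanSpace ℝ (Fin d) × EuclideanSpace ℝ (Fin d) => W p.1 p.2)
        (cocompact _) atTop ∧
      ∃ c₀ C₀ : ℝ, 0 < c₀ ∧ 0 < C₀ ∧
        ∀ x v : EuclideanSpace ℝ (Fin d),
          fderiv ℝ (fun y => W y v) x (a • x + b • v)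
            + fderiv ℝ (fun w => W x w) v (U (x, v))
            + ∫ u, (W x (v + u) - W x v
                - (if ‖u‖ ≤ 1 then fderiv ℝ (fun w => W x w) v u else 0)) ∂ν ≤
          -c₀ * W x v + C₀ := by
  obtain ⟨hθ0, hθ1⟩ := hθ
  set κ := (1 - |r₀| / r) / 2 with hκdef
  have hκ : 0 < κ := by
    have : |r₀| / r < 1 := (div_lt_one hr).2 hr₀r
    rw [hκdef]; linarith
  have hVlow : ∀ x v, 1 + κ * (r ^ 2 * ‖x‖ ^ 2 + ‖v‖ ^ 2) ≤ V x v := fun x v => by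
    rw [hVdef, hκdef]; linarith [quadratic_form_coercive (r₀ := r₀) hr x v, hV₀nn x]
  have hV1 : ∀ x v, 1 ≤ V x v := fun x v => by
    have : 0 ≤ κ * (r ^ 2 * ‖x‖ ^ 2 + ‖v‖ ^ 2) := by positivity
    linarith [hVlow x v]
  obtain rfl : W = fun x v => 1 + V x v ^ (θ / 2) := by
    ext x v; exact hWdef x v
  refine ⟨fun x v => ?_, ?_, ?_⟩
  · have : 0 ≤ V x v ^ (θ / 2) := Real.rpow_nonneg (zero_le_one.trans (hV1 x v)) _
    simpa using this
  · refine tendsto_atTop_add_const_left _ 1 ((tendsto_rpow_atTop (by positivity)).comp ?_)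
    have hm : 0 < κ * min (r ^ 2) 1 := by positivity
    refine tendsto_atTop_mono (fun p => ?_) (((tendsto_pow_atTop two_ne_zero).comp
      (tendsto_norm_cocompact_atTop
        (E := EuclideanSpace ℝ (Fin d) × EuclideanSpace ℝ (Fin d)))).const_mul_atTop hm)
    have hp : ‖p‖ ^ 2 ≤ ‖p.1‖ ^ 2 + ‖p.2‖ ^ 2 := by
      rcases max_choice ‖p.1‖ ‖p.2‖ with h | h <;> rw [Prod.norm_def, h] <;>
        linarith [sq_nonneg ‖p.1‖, sq_nonneg ‖p.2‖]
    calc κ * min (r ^ 2) 1 * ‖p‖ ^ 2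
        ≤ κ * (min (r ^ 2) 1 * ‖p.1‖ ^ 2 + min (r ^ 2) 1 * ‖p.2‖ ^ 2) := by
          rw [mul_assoc, ← mul_add]; gcongr
      _ ≤ κ * (r ^ 2 * ‖p.1‖ ^ 2 + 1 * ‖p.2‖ ^ 2) := by
          gcongr
          · exact min_le_left _ _
          · exact min_le_right _ _
      _ ≤ V p.1 p.2 := by linarith [hVlow p.1 p.2]
  · have hdv : ∀ x v u, fderiv ℝ (fun w => 1 + V x w ^ (θ / 2)) v u =
        θ / 2 * V x v ^ (θ / 2 - 1) * ⟪v + r₀ • x, u⟫ := fun x v u => by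
      refine fderiv_one_add_rpow ?_ (zero_lt_one.trans_le (hV1 x v)) u
      simpa only [funext (hVdef x)] using hasFDerivAt_energy_velocity V₀ r₀ r x v
    have hdx : ∀ x v u, fderiv ℝ (fun y => 1 + V y v ^ (θ / 2)) x u =
        θ / 2 * V x v ^ (θ / 2 - 1) * ⟪(r ^ 2) • x + r₀ • v + gradient V₀ x, u⟫ :=
      fun x v u => by
        refine fderiv_one_add_rpow (f := fun y => V y v) ?_ (zero_lt_one.trans_le (hV1 x v)) u
        simpa only [hVdef] using hasFDerivAt_energy_position
          ((hV₀smooth.differentiable one_ne_zero) x) r₀ r v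
    set g : EuclideanSpace ℝ (Fin d) → ℝ := fun u => min (‖u‖ ^ 2) (‖u‖ ^ θ) with hgdef
    have hg0 : ∀ u, 0 ≤ g u := fun u => by positivity
    have hgm : Measurable g := by fun_prop
    have hg : Integrable g ν := by
      refine ⟨hgm.aestronglyMeasurable, ?_⟩
      rwa [hasFiniteIntegral_iff_ofReal (Eventually.of_forall hg0)]
    set M := 1 + (1 + 1 / √(κ / 2)) ^ θ
    have hM : 0 ≤ M := by positivity
    have hI : 0 ≤ ∫ u, M * g u ∂ν := integral_nonneg fun u => mul_nonneg hM (hg0 u)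
    have hjump : ∀ x v, ∫ u, ((1 + V x (v + u) ^ (θ / 2)) - (1 + V x v ^ (θ / 2))
        - (if ‖u‖ ≤ 1 then fderiv ℝ (fun w => 1 + V x w ^ (θ / 2)) v u else 0)) ∂ν ≤
          ∫ u, M * g u ∂ν := fun x v => by
      refine integral_le_of_le_of_integral_nonneg (hg.const_mul M) hI fun u => ?_
      rw [add_sub_add_left_eq_sub]
      refine jump_le (y := v + r₀ • x) hθ0 hθ1 (half_pos hκ) (hV1 x v) (hV1 x (v + u)) ?_ ?_
        (hdv x v u)
      · have := mul_le_mul_of_nonneg_left (norm_add_smul_sq_le hr₀r.le x v) (half_pos hκ).le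
        linarith [hVlow x v]
      · rw [hVdef, hVdef, norm_add_sq_real, inner_add_right, inner_add_left, real_inner_smul_left]
        ring
    set K := 1 + r ^ 2
    have hK : 1 ≤ K := by simp only [K]; nlinarith
    have hK0 : 0 < K := by positivity
    have hVup : ∀ x v, V x v ≤ 1 + K * (V₀ x + ‖x‖ ^ 2 + ‖v‖ ^ 2) := fun x v => by
      rw [hVdef]; nlinarith [quadratic_form_le hr₀r.le x v, hV₀nn x]
    set c₁ := θ / 2 * (c / K)
    refine ⟨c₁, c₁ + (c / K + C) + ∫ u, M * g u ∂ν, by positivity, by positivity,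
      fun x v => ?_⟩
    have hVpos : 0 < V x v := zero_lt_one.trans_le (hV1 x v)
    have hdr : ⟪(r ^ 2) • x + r₀ • v + gradient V₀ x, a • x + b • v⟫ + ⟪v + r₀ • x, U (x, v)⟫ ≤
        -(c / K) * V x v + (c / K + C) := by
      refine (hdrift x v).trans ?_
      have h := mul_le_mul_of_nonneg_left (hVup x v) (div_pos hc hK0).le
      have hcK : c / K * (1 + K * (V₀ x + ‖x‖ ^ 2 + ‖v‖ ^ 2)) =
          c / K + c * (V₀ x + ‖x‖ ^ 2 + ‖v‖ ^ 2) := by field_simp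
      linarith
    have hs0 : 0 ≤ θ / 2 * V x v ^ (θ / 2 - 1) := by positivity
    have hs1 : θ / 2 * V x v ^ (θ / 2 - 1) ≤ 1 :=
      mul_le_one₀ (by linarith) (by positivity) (rpow_sub_one_le_one (hV1 x v) (by linarith))
    have hVV : V x v ^ (θ / 2 - 1) * V x v = V x v ^ (θ / 2) := by
      rw [Real.rpow_sub_one hVpos.ne']; field_simp
    have hloc := mul_le_mul_of_nonneg_left hdr hs0
    have hrem := mul_le_mul_of_nonneg_right hs1 (show 0 ≤ c / K + C by positivity)
    have hmain : θ / 2 * V x v ^ (θ / 2 - 1) * (-(c / K) * V x v + (c / K + C)) =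
        -c₁ * V x v ^ (θ / 2) + θ / 2 * V x v ^ (θ / 2 - 1) * (c / K + C) := by
      rw [← hVV]; ring
    have hj := hjump x v
    beta_reduce
    rw [hdx x v, hdv x v (U (x, v))]
    linarith
end

section
/- Let d ≥ 1, c > 0 and θ_0 ∈ (0,2), and let ν* be the measure on ℝ^d with density ν*(dz) = c·|z|^{−d−θ_0}·1_{{0 < z_1 ≤ 1}} dz with respect to Lebesgue measure, where z_1 is the first coordinate of z. Define J(s) := inf_{|x| ≤ s} ( ν* ⊓ (δ_x * ν*) )(ℝ^d) for s > 0. Then there exist constants c_0 > 0 and r_0 > 0 such that J(r) ≥ c_0 r^{−θ_0} for all r ∈ (0, r_0]. -/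
open MeasureTheory Set
open scoped ENNReal

/-- A density bounded below by `k` on a measurable set `A` dominates `k` times the restriction of
the base measure to `A`. -/
theorem smul_restrict_le_withDensity {α : Type*} [MeasurableSpace α] {μ : Measure α} {A : Set α}
    (hA : MeasurableSet A) {k : ℝ≥0∞} {f : α → ℝ≥0∞} (h : ∀ y ∈ A, k ≤ f y) :
    k • μ.restrict A ≤ μ.withDensity f := by
  rw [← withDensity_const]
  calc (μ.restrict A).withDensity (fun _ => k) ≤ (μ.restrict A).withDensity f :=
        withDensity_mono ((ae_restrict_iff' hA).2 (Filter.Eventually.of_forall h))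
    _ = (μ.withDensity f).restrict A := (restrict_withDensity hA f).symm
    _ ≤ μ.withDensity f := Measure.restrict_le_self

/-- On the ball of radius `2 * s` around `3 * s` times the first basis vector, a power density with
nonpositive exponent cut off to `0 < z₁ ≤ 1` is at least its value at radius `5 * s`. -/
theorem le_truncated_rpow_norm_of_dist_lt {d : ℕ} {i : Fin d} {c p s : ℝ} (hc : 0 ≤ c)
    (hp : p ≤ 0) (hs : s ≤ 1 / 5) {y : EuclideanSpace ℝ (Fin d)}
    (hy : dist y (EuclideanSpace.single i (3 * s)) < 2 * s) :
    c * (5 * s) ^ p ≤ if 0 < y i ∧ y i ≤ 1 then c * ‖y‖ ^ p else 0 := by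
  rw [dist_eq_norm] at hy
  have hs0 : 0 < s := by linarith [norm_nonneg (y - EuclideanSpace.single i (3 * s))]
  have h1 : |y i - 3 * s| < 2 * s := by
    have h := PiLp.norm_apply_le (y - EuclideanSpace.single i (3 * s)) i
    simp only [PiLp.sub_apply, PiLp.single_apply, if_true, Real.norm_eq_abs] at h
    exact h.trans_lt hy
  obtain ⟨hlow, hup⟩ := abs_lt.1 h1
  have hnorm : ‖y‖ ≤ 5 * s := by
    have h := norm_le_norm_add_norm_sub (EuclideanSpace.single i (3 * s)) y
    rw [norm_sub_rev] at h
    have h' : ‖(EuclideanSpace.single i (3 * s) : EuclideanSpace ℝ (Fin d))‖ = 3 * s := by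
      rw [PiLp.norm_single, Real.norm_eq_abs, abs_of_pos (by positivity)]
    linarith
  have hpos : 0 < ‖y‖ := by
    have h := (le_abs_self _).trans (PiLp.norm_apply_le y i)
    linarith
  rw [if_pos ⟨by linarith, by linarith⟩]
  exact mul_le_mul_of_nonneg_left (Real.rpow_le_rpow_of_nonpos hpos hnorm hp) hc

/-- for the degenerate measure `ν*(dz) = c |z|^{−d−θ₀} 1_{0 < z₁ ≤ 1} dz` with
`θ₀ ∈ (0,2)`, the function `J(s) = inf_{|x| ≤ s} (ν* ⊓ (δ_x * ν*))(ℝ^d)` satisfies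
`J(r) ≥ c₀ r^{−θ₀}` for all `r ∈ (0, r₀]`, for some constants `c₀, r₀ > 0`. -/
theorem stmt11 (d : ℕ) (hd : 0 < d) (c θ₀ : ℝ) (hc : 0 < c)
    (hθ₀ : θ₀ ∈ Set.Ioo (0 : ℝ) 2)
    (νstar : Measure (EuclideanSpace ℝ (Fin d)))
    (hνstar : νstar = MeasureTheory.volume.withDensity (fun z =>
      ENNReal.ofReal (if 0 < z ⟨0, hd⟩ ∧ z ⟨0, hd⟩ ≤ 1
        then c * ‖z‖ ^ (-(d : ℝ) - θ₀) else 0))) :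
    ∃ c₀ r₀ : ℝ, 0 < c₀ ∧ 0 < r₀ ∧ ∀ s : ℝ, 0 < s → s ≤ r₀ →
      ENNReal.ofReal (c₀ * s ^ (-θ₀)) ≤
        ⨅ (x : EuclideanSpace ℝ (Fin d)) (_ : ‖x‖ ≤ s),
          (νstar ⊓ Measure.map (fun u => u + x) νstar) Set.univ := by
  have hp : -(d : ℝ) - θ₀ ≤ 0 := by
    have := hθ₀.1
    have : (0 : ℝ) ≤ d := d.cast_nonneg
    linarith
  set V := volume (Metric.ball (0 : EuclideanSpace ℝ (Fin d)) 1)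
  have hVtop : V ≠ ∞ := measure_ball_lt_top.ne
  have hVpos : 0 < V.toReal :=
    ENNReal.toReal_pos (Metric.measure_ball_pos _ _ one_pos).ne' hVtop
  refine ⟨c * 5 ^ (-(d : ℝ) - θ₀) * V.toReal, 1 / 5, by positivity, by norm_num,
    fun s hs hs5 => le_iInf₂ fun x hx => ?_⟩
  set e : EuclideanSpace ℝ (Fin d) := EuclideanSpace.single ⟨0, hd⟩ (3 * s)
  set k := ENNReal.ofReal (c * (5 * s) ^ (-(d : ℝ) - θ₀)) with hk
  have hdens {A : Set (EuclideanSpace ℝ (Fin d))} (hA : MeasurableSet A)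
      (h : ∀ y ∈ A, dist y e < 2 * s) : k • volume.restrict A ≤ νstar := by
    rw [hνstar]
    exact smul_restrict_le_withDensity hA fun y hy =>
      ENNReal.ofReal_le_ofReal (le_truncated_rpow_norm_of_dist_lt hc.le hp hs5 (h y hy))
  have hB : MeasurableSet (Metric.ball e s) := measurableSet_ball
  have hadd : Measurable (fun u : EuclideanSpace ℝ (Fin d) => u + x) := measurable_add_const x
  have hleft : k • volume.restrict (Metric.ball e s) ≤ νstar :=
    hdens hB fun y hy => by linarith [Metric.mem_ball.1 hy]
  have hright : k • volume.restrict (Metric.ball e s) ≤ Measure.map (fun u => u + x) νstar := by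
    have hpre : k • volume.restrict ((fun u => u + x) ⁻¹' Metric.ball e s) ≤ νstar := by
      refine hdens (hadd hB) fun y hy => ?_
      have h1 : dist (y + x) e < s := hy
      have h2 : dist y (y + x) = ‖x‖ := by simp
      linarith [dist_triangle y (y + x) e]
    have hmap := Measure.map_mono hpre hadd
    rwa [Measure.map_smul, ← Measure.restrict_map hadd hB, map_add_right_eq_self] at hmap
  have hpow : c * 5 ^ (-(d : ℝ) - θ₀) * V.toReal * s ^ (-θ₀) =
      c * (5 * s) ^ (-(d : ℝ) - θ₀) * (s ^ d * V.toReal) := by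
    have hsplit : s ^ (-θ₀) = s ^ (-(d : ℝ) - θ₀) * s ^ d := by
      rw [← Real.rpow_natCast s d, ← Real.rpow_add hs]
      ring_nf
    rw [Real.mul_rpow (by norm_num) hs.le, hsplit]
    ring
  calc ENNReal.ofReal (c * 5 ^ (-(d : ℝ) - θ₀) * V.toReal * s ^ (-θ₀))
      = k * volume (Metric.ball e s) := by
        rw [hpow, ENNReal.ofReal_mul (by positivity), ← hk, ENNReal.ofReal_mul (by positivity),
          ENNReal.ofReal_toReal hVtop, Measure.addHaar_ball_of_pos _ _ hs,
          finrank_euclideanSpace_fin]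
    _ = (k • volume.restrict (Metric.ball e s)) univ := by simp
    _ ≤ _ := le_inf hleft hright univ
end

section
/- Let θ ∈ (0,1], let 𝒱_0 : ℝ^d → [0,∞), and let r_0 ∈ ℝ, r > 0 with |r_0| < r. Define 𝒱(x,v) := 1 + 𝒱_0(x) + (r²/2)|x|² + (1/2)|v|² + r_0⟨x,v⟩ and 𝒲(x,v) := 1 + 𝒱(x,v)^{θ/2}. Then there exists a constant c_2 > 0 such that for all x, v, u ∈ ℝ^d: |𝒲(x, v+u) − 𝒲(x,v)| ≤ c_2 𝒲(x,v)^{1/2} ( |u|^{θ/2} + |u|^θ ). -/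
open MeasureTheory Set
open scoped RealInnerProductSpace

/-- For `p ∈ [0, 1]`, the map `t ↦ t ^ p` on `[0, ∞)` is `p`-Hölder with constant one. -/
lemma abs_rpow_sub_rpow_le {a b p : ℝ} (ha : 0 ≤ a) (hb : 0 ≤ b) (hp : 0 ≤ p) (hp1 : p ≤ 1) :
    |a ^ p - b ^ p| ≤ |a - b| ^ p := by
  have key : ∀ {a b : ℝ}, 0 ≤ a → 0 ≤ b → a ^ p ≤ b ^ p + |a - b| ^ p := fun {a b} ha hb =>
    (Real.rpow_le_rpow ha (by linarith [le_abs_self (a - b)]) hp).trans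
      (Real.rpow_add_le_add_rpow hb (abs_nonneg (a - b)) hp hp1)
  have h := key hb ha
  rw [abs_sub_comm b a] at h
  exact abs_sub_le_iff.2 ⟨by linarith [key ha hb], by linarith⟩

/-- for `𝒱(x,v) = 1 + 𝒱₀(x) + (r²/2)|x|² + (1/2)|v|² + r₀⟨x,v⟩` with
`𝒱₀ ≥ 0` and `|r₀| < r`, and `𝒲 = 1 + 𝒱^{θ/2}`, there is a constant `c₂ > 0` such that
`|𝒲(x,v+u) − 𝒲(x,v)| ≤ c₂ 𝒲(x,v)^{1/2} (|u|^{θ/2} + |u|^θ)` for all `x, v, u`. -/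
theorem stmt12 (d : ℕ) (θ : ℝ) (hθ : θ ∈ Set.Ioc (0 : ℝ) 1)
    (V₀ : EuclideanSpace ℝ (Fin d) → ℝ) (hV₀nn : ∀ x, 0 ≤ V₀ x)
    (r₀ r : ℝ) (hr₀r : |r₀| < r) (hr : 0 < r)
    (V W : EuclideanSpace ℝ (Fin d) → EuclideanSpace ℝ (Fin d) → ℝ)
    (hVdef : ∀ x v, V x v =
      1 + V₀ x + (r ^ 2 / 2) * ‖x‖ ^ 2 + (1 / 2) * ‖v‖ ^ 2 + r₀ * ⟪x, v⟫)
    (hWdef : ∀ x v, W x v = 1 + V x v ^ (θ / 2)) :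
    ∃ c₂ : ℝ, 0 < c₂ ∧ ∀ x v u : EuclideanSpace ℝ (Fin d),
      |W x (v + u) - W x v| ≤ c₂ * W x v ^ (1 / 2 : ℝ) * (‖u‖ ^ (θ / 2) + ‖u‖ ^ θ) := by
  obtain ⟨hθ0, hθ1⟩ := hθ
  refine ⟨2, two_pos, fun x v u => ?_⟩
  have hr2 : r₀ ^ 2 ≤ r ^ 2 := sq_le_sq' (by linarith [neg_abs_le r₀]) (by linarith [le_abs_self r₀])
  have hlow : ∀ w, 1 + ‖w + r₀ • x‖ ^ 2 / 2 ≤ V x w := fun w => by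
    rw [hVdef, norm_add_sq_real, inner_smul_right, norm_smul, mul_pow, Real.norm_eq_abs, sq_abs,
      real_inner_comm]
    nlinarith [hV₀nn x, mul_le_mul_of_nonneg_right hr2 (sq_nonneg ‖x‖)]
  have hV1 : ∀ w, 1 ≤ V x w := fun w => by linarith [hlow w, sq_nonneg ‖w + r₀ • x‖]
  have hV0 : 0 ≤ V x v := by linarith [hV1 v]
  have hinc : V x (v + u) - V x v = ⟪v + r₀ • x, u⟫ + ‖u‖ ^ 2 / 2 := by
    rw [hVdef, hVdef, norm_add_sq_real, inner_add_right, inner_add_left, real_inner_smul_left]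
    ring
  have hs : ‖v + r₀ • x‖ ≤ 2 * √(V x v) := by
    refine abs_le_of_sq_le_sq' ?_ (by positivity) |>.2
    rw [mul_pow, Real.sq_sqrt hV0]
    linarith [hlow v]
  have hdiff : |V x (v + u) - V x v| ≤ 2 * √(V x v) * ‖u‖ + ‖u‖ ^ 2 := by
    rw [hinc]
    refine (abs_add_le _ _).trans (add_le_add ?_ ?_)
    · exact (abs_real_inner_le_norm _ _).trans (by gcongr)
    · rw [abs_of_nonneg (by positivity)]
      linarith [sq_nonneg ‖u‖]
  have hW1 : 1 ≤ W x v := by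
    rw [hWdef]
    linarith [Real.rpow_nonneg hV0 (θ / 2)]
  have hWhalf : 1 ≤ W x v ^ (1 / 2 : ℝ) := Real.one_le_rpow hW1 (by norm_num)
  have hsqrt : √(V x v) ^ (θ / 2) ≤ W x v ^ (1 / 2 : ℝ) := by
    rw [Real.sqrt_eq_rpow, ← Real.rpow_mul hV0, mul_comm, Real.rpow_mul hV0]
    refine Real.rpow_le_rpow (by positivity) ?_ (by norm_num)
    rw [hWdef]
    linarith
  have htwo : (2 : ℝ) ^ (θ / 2) ≤ 2 :=
    (Real.rpow_le_rpow_of_exponent_le one_le_two (by linarith)).trans_eq (Real.rpow_one 2)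
  have hu : (‖u‖ ^ 2) ^ (θ / 2) = ‖u‖ ^ θ := by
    rw [← Real.rpow_natCast_mul (norm_nonneg u)]
    congr 1
    push_cast
    ring
  calc |W x (v + u) - W x v| = |V x (v + u) ^ (θ / 2) - V x v ^ (θ / 2)| := by
        rw [hWdef, hWdef, add_sub_add_left_eq_sub]
    _ ≤ |V x (v + u) - V x v| ^ (θ / 2) :=
        abs_rpow_sub_rpow_le (by linarith [hV1 (v + u)]) hV0 (by linarith) (by linarith)
    _ ≤ (2 * √(V x v) * ‖u‖ + ‖u‖ ^ 2) ^ (θ / 2) :=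
        Real.rpow_le_rpow (abs_nonneg _) hdiff (by linarith)
    _ ≤ (2 * √(V x v) * ‖u‖) ^ (θ / 2) + (‖u‖ ^ 2) ^ (θ / 2) :=
        Real.rpow_add_le_add_rpow (by positivity) (by positivity) (by linarith) (by linarith)
    _ = 2 ^ (θ / 2) * √(V x v) ^ (θ / 2) * ‖u‖ ^ (θ / 2) + 1 * ‖u‖ ^ θ := by
        rw [Real.mul_rpow (by positivity) (norm_nonneg u),
          Real.mul_rpow two_pos.le (Real.sqrt_nonneg _), hu, one_mul]
    _ ≤ 2 * W x v ^ (1 / 2 : ℝ) * ‖u‖ ^ (θ / 2) + 2 * W x v ^ (1 / 2 : ℝ) * ‖u‖ ^ θ := by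
        gcongr
        linarith
    _ = 2 * W x v ^ (1 / 2 : ℝ) * (‖u‖ ^ (θ / 2) + ‖u‖ ^ θ) := by ring
end

section
/- Let d ≥ 1, c > 0, θ ∈ (0,1] and θ_0 ∈ (0, θ/2), and let ν* be the measure on ℝ^d with density ν*(du) = c·|u|^{−d−θ_0}·1_{{0 < u_1 ≤ 1}} du with respect to Lebesgue measure, where u_1 is the first coordinate of u. Let 𝒱_0 : ℝ^d → [0,∞), let r_0 ∈ ℝ, r > 0 with |r_0| < r, and set 𝒱(x,v) := 1 + 𝒱_0(x) + (r²/2)|x|² + (1/2)|v|² + r_0⟨x,v⟩ and 𝒲(x,v) := 1 + 𝒱(x,v)^{θ/2}. Then there exists a constant c_3 > 0 such that for all x, v ∈ ℝ^d: ∫_{ℝ^d} |𝒲(x, v+u) − 𝒲(x,v)| ν*(du) ≤ c_3 𝒲(x,v)^{1/2}. -/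
open MeasureTheory Set
open scoped ENNReal RealInnerProductSpace

theorem Real.abs_rpow_sub_rpow_le_of_abs_sub_le {a b t p : ℝ} (ha : 0 ≤ a) (hb : 0 ≤ b)
    (hab : |a - b| ≤ t) (hp : 0 ≤ p) (hp1 : p ≤ 1) : |a ^ p - b ^ p| ≤ t ^ p := by
  have ht : 0 ≤ t := (abs_nonneg _).trans hab
  obtain ⟨h₁, h₂⟩ := abs_le.1 hab
  have key {x y : ℝ} (hx : 0 ≤ x) (hy : 0 ≤ y) (h : x ≤ y + t) : x ^ p ≤ y ^ p + t ^ p :=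
    (Real.rpow_le_rpow hx h hp).trans (Real.rpow_add_le_add_rpow hy ht hp hp1)
  have h₃ := key ha hb (by linarith)
  have h₄ := key hb ha (by linarith)
  exact abs_le.2 ⟨by linarith, by linarith⟩

/-- The map `q ↦ √(A + ‖q‖² / 2)` is nonexpansive. -/
theorem abs_sqrt_add_half_norm_sq_sub_le {E : Type*} [NormedAddCommGroup E] {A : ℝ} (hA : 0 ≤ A)
    (p q : E) : |√(A + 1 / 2 * ‖p‖ ^ 2) - √(A + 1 / 2 * ‖q‖ ^ 2)| ≤ ‖p - q‖ := by
  have key (p q : E) : √(A + 1 / 2 * ‖p‖ ^ 2) ≤ √(A + 1 / 2 * ‖q‖ ^ 2) + ‖p - q‖ := by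
    have hs := Real.sq_sqrt (show 0 ≤ A + 1 / 2 * ‖q‖ ^ 2 by positivity)
    have hs0 := Real.sqrt_nonneg (A + 1 / 2 * ‖q‖ ^ 2)
    have hpq : ‖p‖ ≤ ‖q‖ + ‖p - q‖ := norm_le_norm_add_norm_sub' p q
    set s := √(A + 1 / 2 * ‖q‖ ^ 2)
    have hqs : ‖q‖ ≤ 2 * s :=
      abs_le_of_sq_le_sq' (by nlinarith [norm_nonneg q]) (by positivity) |>.2
    refine Real.sqrt_le_iff.2 ⟨by positivity, ?_⟩
    nlinarith [norm_nonneg p, norm_nonneg q, norm_nonneg (p - q),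
      mul_le_mul_of_nonneg_right hqs (norm_nonneg (p - q)), pow_le_pow_left₀ (norm_nonneg p) hpq 2]
  have h₁ := key p q
  have h₂ := key q p
  rw [norm_sub_rev q p] at h₂
  exact abs_le.2 ⟨by linarith, by linarith⟩

theorem integrable_indicator_mul_prod_one_add_abs {ι : Type*} [Fintype ι] [DecidableEq ι] (i₀ : ι)
    {β : ℝ} (hβ : 1 < β) :
    Integrable (fun u : EuclideanSpace ℝ ι => (Ioc (0 : ℝ) 1).indicator 1 (u i₀) *
      ∏ i ∈ Finset.univ.erase i₀, (1 + |u i|) ^ (-β)) := by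
  have hf (i : ι) : Integrable (fun x : ℝ =>
      if i = i₀ then (Ioc (0 : ℝ) 1).indicator 1 x else (1 + |x|) ^ (-β)) := by
    split_ifs
    · exact (integrable_indicator_iff measurableSet_Ioc).2 (integrableOn_const (by simp))
    · exact integrable_one_add_norm (E := ℝ) (by simpa using hβ)
  refine ((PiLp.volume_preserving_ofLp ι).integrable_comp_of_integrable
    (Integrable.fintype_prod hf)).congr (.of_forall fun u => ?_)
  simp only [Function.comp_apply]
  rw [← Finset.mul_prod_erase _ _ (Finset.mem_univ i₀), if_pos rfl]
  congr 1
  exact Finset.prod_congr rfl fun i hi => if_neg (Finset.ne_of_mem_erase hi)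

theorem one_add_norm_rpow_neg_le_prod {ι : Type*} [Fintype ι] [DecidableEq ι] (i₀ : ι)
    {β s : ℝ} (hβ : 0 ≤ β) (hβs : β * (Fintype.card ι - 1) ≤ s) (u : EuclideanSpace ℝ ι) :
    (1 + ‖u‖) ^ (-s) ≤ ∏ i ∈ Finset.univ.erase i₀, (1 + |u i|) ^ (-β) := by
  have hcard : (((Finset.univ.erase i₀).card : ℕ) : ℝ) = Fintype.card ι - 1 := by
    rw [Finset.card_erase_of_mem (Finset.mem_univ _), Finset.card_univ,
      Nat.cast_sub (Fintype.card_pos_iff.2 ⟨i₀⟩), Nat.cast_one]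
  calc (1 + ‖u‖) ^ (-s) ≤ (1 + ‖u‖) ^ (-β * (Fintype.card ι - 1)) :=
        Real.rpow_le_rpow_of_exponent_le (by simp) (by linarith)
    _ = ∏ i ∈ Finset.univ.erase i₀, (1 + ‖u‖) ^ (-β) := by
        rw [Finset.prod_const, ← hcard, Real.rpow_mul_natCast (by positivity)]
    _ ≤ _ := Finset.prod_le_prod (fun i _ => by positivity) fun i _ =>
        Real.rpow_le_rpow_of_nonpos (by positivity)
          (by gcongr; exact PiLp.norm_apply_le u i) (by linarith)

theorem measurableSet_strip {ι : Type*} [Fintype ι] (i₀ : ι) :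
    MeasurableSet {u : EuclideanSpace ℝ ι | 0 < u i₀ ∧ u i₀ ≤ 1} := by
  measurability

/-- A power `‖u‖ ^ (-s)` with `n - 1 < s < n` is integrable on the strip `0 < u i₀ ≤ 1`. -/
theorem integrableOn_strip_norm_rpow_neg {ι : Type*} [Fintype ι] (i₀ : ι) {s : ℝ}
    (hs₁ : Fintype.card ι - 1 < s) (hs₂ : s < Fintype.card ι) :
    IntegrableOn (fun u : EuclideanSpace ℝ ι => ‖u‖ ^ (-s)) {u | 0 < u i₀ ∧ u i₀ ≤ 1} := by
  classical
  have hn : (1 : ℝ) ≤ Fintype.card ι := by exact_mod_cast Fintype.card_pos_iff.2 ⟨i₀⟩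
  have hs : 0 < s := by linarith
  obtain ⟨β, hβ, hβs⟩ : ∃ β : ℝ, 1 < β ∧ β * (Fintype.card ι - 1) ≤ s := by
    rcases hn.eq_or_lt with h | h
    · exact ⟨2, one_lt_two, by rw [← h]; linarith⟩
    · have h' : (0 : ℝ) < Fintype.card ι - 1 := by linarith
      exact ⟨s / (Fintype.card ι - 1), (one_lt_div h').2 hs₁, (div_mul_cancel₀ _ h'.ne').le⟩
  have hmeas : Measurable fun u : EuclideanSpace ℝ ι => ‖u‖ ^ (-s) := by fun_prop
  have near : IntegrableOn (fun u : EuclideanSpace ℝ ι => ‖u‖ ^ (-s)) (Metric.ball 0 1) := by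
    refine integrableOn_ball_of_norm_le_rpow (C := 1) (α := s) ?_ ?_ (.of_forall fun u => ?_)
      hmeas.aestronglyMeasurable
    · rw [finrank_euclideanSpace]; exact_mod_cast hn
    · rwa [finrank_euclideanSpace]
    · rw [one_mul, Real.norm_of_nonneg (by positivity)]
  have far : IntegrableOn (fun u : EuclideanSpace ℝ ι => ‖u‖ ^ (-s))
      ({u | 0 < u i₀ ∧ u i₀ ≤ 1} \ Metric.ball 0 1) := by
    refine Integrable.mono' ((integrable_indicator_mul_prod_one_add_abs i₀ hβ).const_mul
      (2 ^ s)).integrableOn hmeas.aestronglyMeasurable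
      (ae_restrict_of_forall_mem ((measurableSet_strip i₀).diff Metric.isOpen_ball.measurableSet)
        fun u hu => ?_)
    have hu1 : 1 ≤ ‖u‖ := by simpa using hu.2
    rw [Real.norm_of_nonneg (by positivity), indicator_of_mem (show u i₀ ∈ Ioc 0 1 from hu.1),
      Pi.one_apply, one_mul]
    calc ‖u‖ ^ (-s) = 2 ^ s * (2 * ‖u‖) ^ (-s) := by
          rw [Real.mul_rpow zero_le_two (norm_nonneg u), ← mul_assoc,
            ← Real.rpow_add zero_lt_two, add_neg_cancel, Real.rpow_zero, one_mul]
      _ ≤ 2 ^ s * (1 + ‖u‖) ^ (-s) := by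
          gcongr ?_ * ?_
          exact Real.rpow_le_rpow_of_nonpos (by positivity) (by linarith) (by linarith)
      _ ≤ _ := by
          gcongr
          exact one_add_norm_rpow_neg_le_prod i₀ (by linarith) hβs u
  exact (near.union far).mono_set fun u hu => by
    by_cases h : u ∈ Metric.ball 0 1
    exacts [.inl h, .inr ⟨hu, h⟩]

/-- for the degenerate measure `ν*(du) = c |u|^{−d−θ₀} 1_{0 < u₁ ≤ 1} du` with
`θ ∈ (0,1]`, `θ₀ ∈ (0, θ/2)`, and the Lyapunov function `𝒲 = 1 + 𝒱^{θ/2}` with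
`𝒱(x,v) = 1 + 𝒱₀(x) + (r²/2)|x|² + (1/2)|v|² + r₀⟨x,v⟩`, there is a constant `c₃ > 0` with
`∫ |𝒲(x,v+u) − 𝒲(x,v)| ν*(du) ≤ c₃ 𝒲(x,v)^{1/2}` for all `x, v`. -/
theorem stmt14 (d : ℕ) (hd : 0 < d) (c θ θ₀ : ℝ) (hc : 0 < c)
    (hθ : θ ∈ Set.Ioc (0 : ℝ) 1) (hθ₀ : θ₀ ∈ Set.Ioo (0 : ℝ) (θ / 2))
    (νstar : Measure (EuclideanSpace ℝ (Fin d)))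
    (hνstar : νstar = MeasureTheory.volume.withDensity (fun u =>
      ENNReal.ofReal (if 0 < u ⟨0, hd⟩ ∧ u ⟨0, hd⟩ ≤ 1
        then c * ‖u‖ ^ (-(d : ℝ) - θ₀) else 0)))
    (V₀ : EuclideanSpace ℝ (Fin d) → ℝ) (hV₀nn : ∀ x, 0 ≤ V₀ x)
    (r₀ r : ℝ) (hr₀r : |r₀| < r) (hr : 0 < r)
    (V W : EuclideanSpace ℝ (Fin d) → EuclideanSpace ℝ (Fin d) → ℝ)
    (hVdef : ∀ x v, V x v =
      1 + V₀ x + (r ^ 2 / 2) * ‖x‖ ^ 2 + (1 / 2) * ‖v‖ ^ 2 + r₀ * ⟪x, v⟫)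
    (hWdef : ∀ x v, W x v = 1 + V x v ^ (θ / 2)) :
    ∃ c₃ : ℝ, 0 < c₃ ∧ ∀ x v : EuclideanSpace ℝ (Fin d),
      ∫ u, |W x (v + u) - W x v| ∂νstar ≤ c₃ * W x v ^ (1 / 2 : ℝ) := by
  have hα₀ : 0 < θ - θ₀ := by linarith [hθ₀.1, hθ₀.2, hθ.1]
  have hα₁ : θ - θ₀ < 1 := by linarith [hθ₀.1, hθ.2]
  have hdens : Measurable fun u : EuclideanSpace ℝ (Fin d) =>
      ENNReal.ofReal (if 0 < u ⟨0, hd⟩ ∧ u ⟨0, hd⟩ ≤ 1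
        then c * ‖u‖ ^ (-(d : ℝ) - θ₀) else 0) :=
    (Measurable.ite (measurableSet_strip _) (by fun_prop) measurable_const).ennreal_ofReal
  have hint : Integrable (fun u => ‖u‖ ^ θ) νstar := by
    rw [hνstar, integrable_withDensity_iff_integrable_smul' hdens (by simp)]
    have h := (integrableOn_strip_norm_rpow_neg (⟨0, hd⟩ : Fin d) (s := d - (θ - θ₀))
      (by simpa using hα₁) (by simpa using hα₀)).const_mul c
    refine ((integrable_indicator_iff (measurableSet_strip _)).2 h).congr
      (.of_forall fun u => ?_)
    by_cases hu : 0 < u ⟨0, hd⟩ ∧ u ⟨0, hd⟩ ≤ 1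
    · have hu0 : 0 < ‖u‖ := norm_pos_iff.2 fun h => by simp [h] at hu
      simp only [indicator_of_mem (show u ∈ {u : EuclideanSpace ℝ (Fin d) |
        0 < u ⟨0, hd⟩ ∧ u ⟨0, hd⟩ ≤ 1} from hu), if_pos hu, smul_eq_mul]
      rw [ENNReal.toReal_ofReal (by positivity), mul_assoc, ← Real.rpow_add hu0]
      ring_nf
    · simp [hu]
  have hV (x v : EuclideanSpace ℝ (Fin d)) : V x v =
      (1 + V₀ x + (r ^ 2 - r₀ ^ 2) / 2 * ‖x‖ ^ 2) + 1 / 2 * ‖v + r₀ • x‖ ^ 2 := by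
    rw [hVdef, norm_add_sq_real, norm_smul, inner_smul_right, real_inner_comm, mul_pow,
      Real.norm_eq_abs, sq_abs]
    ring
  have hA (x : EuclideanSpace ℝ (Fin d)) :
      0 ≤ 1 + V₀ x + (r ^ 2 - r₀ ^ 2) / 2 * ‖x‖ ^ 2 := by
    have h₁ : 0 ≤ r ^ 2 - r₀ ^ 2 := sub_nonneg.2 (sq_le_sq.2 (hr₀r.le.trans (le_abs_self r)))
    have h₂ := hV₀nn x
    positivity
  have hVnn (x v : EuclideanSpace ℝ (Fin d)) : 0 ≤ V x v := by
    rw [hV]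
    have := hA x
    positivity
  have hW (x v : EuclideanSpace ℝ (Fin d)) : W x v = 1 + √(V x v) ^ θ := by
    rw [hWdef, Real.sqrt_eq_rpow, ← Real.rpow_mul (hVnn x v)]
    ring_nf
  have hdiff (x v u : EuclideanSpace ℝ (Fin d)) : |W x (v + u) - W x v| ≤ ‖u‖ ^ θ := by
    rw [hW, hW, add_sub_add_left_eq_sub]
    refine Real.abs_rpow_sub_rpow_le_of_abs_sub_le (Real.sqrt_nonneg _) (Real.sqrt_nonneg _) ?_
      hθ.1.le hθ.2
    rw [hV, hV]
    refine (abs_sqrt_add_half_norm_sq_sub_le (hA x) _ _).trans_eq ?_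
    congr 1
    abel
  have hK : 0 ≤ ∫ u, ‖u‖ ^ θ ∂νstar := integral_nonneg fun u => by positivity
  refine ⟨(∫ u, ‖u‖ ^ θ ∂νstar) + 1, by positivity, fun x v => ?_⟩
  have hW1 : 1 ≤ W x v ^ (1 / 2 : ℝ) :=
    Real.one_le_rpow (by rw [hW]; simp; positivity) (by norm_num)
  calc ∫ u, |W x (v + u) - W x v| ∂νstar ≤ ∫ u, ‖u‖ ^ θ ∂νstar :=
        integral_mono_of_nonneg (.of_forall fun u => abs_nonneg _) hint
          (.of_forall (hdiff x v))
    _ ≤ ((∫ u, ‖u‖ ^ θ ∂νstar) + 1) * W x v ^ (1 / 2 : ℝ) := by nlinarith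
end

section
/- Let U_0 ∈ C¹(ℝ^d) satisfy liminf_{|x|→∞} U_0(x)/|x|² = ∞, and suppose there exist constants c_3, c_4 > 0 such that ⟨x, ∇U_0(x)⟩ ≥ c_3 U_0(x) − c_4 for all x ∈ ℝ^d. Then there exist constants λ_1 > 0 and λ_2, λ_3, λ_5 ≥ 0 such that for all x ∈ ℝ^d: ⟨x, ∇U_0(x)⟩ ≥ λ_1|x|² + λ_2 U_0(x) − λ_3 and U_0(x) ≥ −λ_5. In particular, Assumption (B_1) of the paper holds with λ_4 = 0 (so that the compatibility conditions λ_2λ_4 < λ_1 and 2βλ_4 ≤ α²/4 + √(β(λ_1 − λ_2λ_4))·α are trivially satisfied for any α, β > 0). -/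
open MeasureTheory Set Filter
open scoped RealInnerProductSpace

/-- A continuous function growing superquadratically at infinity dominates `‖x‖ ^ 2` up to an
additive constant. -/
theorem exists_norm_sq_sub_le_of_tendsto_div_norm_sq {E : Type*} [NormedAddCommGroup E]
    {U : E → ℝ} (hU : Continuous U)
    (hsuper : Tendsto (fun x => U x / ‖x‖ ^ 2) (cocompact E) atTop) :
    ∃ K : ℝ, 0 ≤ K ∧ ∀ x, ‖x‖ ^ 2 - K ≤ U x := by
  obtain ⟨t, ht, hsub⟩ := mem_cocompact.1 (hsuper.eventually_ge_atTop 1)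
  have hcont : Continuous fun x => U x - ‖x‖ ^ 2 := by fun_prop
  obtain ⟨m, hm⟩ := ht.bddBelow_image hcont.continuousOn
  refine ⟨max 0 (-m), le_max_left _ _, fun x => ?_⟩
  by_cases hx : x ∈ t
  · have hmx : m ≤ U x - ‖x‖ ^ 2 := hm (mem_image_of_mem _ hx)
    linarith [le_max_right 0 (-m)]
  · have hdiv : 1 ≤ U x / ‖x‖ ^ 2 := hsub hx
    have hpos : 0 < ‖x‖ ^ 2 := by
      refine (sq_nonneg ‖x‖).lt_of_ne fun h => ?_
      rw [← h, div_zero] at hdiv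
      linarith
    rw [one_le_div hpos] at hdiv
    linarith [le_max_left 0 (-m)]

/-- if `U₀ ∈ C¹(ℝ^d)` satisfies `liminf_{|x|→∞} U₀(x)/|x|² = ∞` and
`⟨x, ∇U₀(x)⟩ ≥ c₃ U₀(x) − c₄`, then Assumption (B₁) holds with `λ₄ = 0`: there exist
`λ₁ > 0` and `λ₂, λ₃, λ₅ ≥ 0` with `⟨x, ∇U₀(x)⟩ ≥ λ₁|x|² + λ₂U₀(x) − λ₃` and
`U₀(x) ≥ −λ₅` for all `x`. -/
theorem stmt16 (d : ℕ) (U₀ : EuclideanSpace ℝ (Fin d) → ℝ) (hU₀ : ContDiff ℝ 1 U₀)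
    (hsuper : Tendsto (fun x : EuclideanSpace ℝ (Fin d) => U₀ x / ‖x‖ ^ 2)
      (cocompact _) atTop)
    (c₃ c₄ : ℝ) (hc₃ : 0 < c₃) (hc₄ : 0 < c₄)
    (hgrowth : ∀ x : EuclideanSpace ℝ (Fin d), c₃ * U₀ x - c₄ ≤ ⟪x, gradient U₀ x⟫) :
    ∃ l₁ l₂ l₃ l₅ : ℝ, 0 < l₁ ∧ 0 ≤ l₂ ∧ 0 ≤ l₃ ∧ 0 ≤ l₅ ∧
      ∀ x : EuclideanSpace ℝ (Fin d),
        l₁ * ‖x‖ ^ 2 + l₂ * U₀ x - l₃ ≤ ⟪x, gradient U₀ x⟫ ∧ -l₅ ≤ U₀ x := by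
  obtain ⟨K, hK, hle⟩ :=
    exists_norm_sq_sub_le_of_tendsto_div_norm_sq hU₀.continuous hsuper
  refine ⟨c₃ / 2, c₃ / 2, c₄ + c₃ / 2 * K, K, by positivity, by positivity, by positivity, hK,
    fun x => ⟨?_, by linarith [hle x, sq_nonneg ‖x‖]⟩⟩
  have hscaled := mul_le_mul_of_nonneg_left (hle x) (half_pos hc₃).le
  linarith [hgrowth x]
end

section
/- Let c_1, c_2 > 0 and l > 0, and define U_0 : ℝ^d → ℝ by U_0(x) := c_1 e^{(1 + |x|²)^l} − c_2|x|². Then U_0 ∈ C¹(ℝ^d), lim_{|x|→∞} U_0(x)/|x|² = ∞, and there exist constants c_3, c_4 > 0 such that ⟨x, ∇U_0(x)⟩ ≥ c_3 U_0(x) − c_4 for all x ∈ ℝ^d. -/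
open MeasureTheory Set Filter
open scoped RealInnerProductSpace

/-- For `l > 0`, the function `e^{s^l}` grows faster than linearly. -/
lemma tendsto_exp_rpow_div_atTop {l : ℝ} (hl : 0 < l) :
    Tendsto (fun s : ℝ => Real.exp (s ^ l) / s) atTop atTop := by
  refine ((tendsto_exp_div_rpow_atTop (1 / l)).comp (tendsto_rpow_atTop hl)).congr' ?_
  filter_upwards [eventually_ge_atTop (0 : ℝ)] with s hs
  simp only [Function.comp]
  rw [← Real.rpow_mul hs, mul_one_div_cancel hl.ne', Real.rpow_one]

/-- A positive multiple of `e^{s^l}` dominates any linear function up to a constant. -/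
lemma exists_mul_le_mul_exp_rpow_add {a b l : ℝ} (ha : 0 < a) (hb : 0 ≤ b) (hl : 0 < l) :
    ∃ K : ℝ, 0 < K ∧ ∀ s : ℝ, 0 ≤ s → b * s ≤ a * Real.exp (s ^ l) + K := by
  obtain ⟨S, hS⟩ := eventually_atTop.1
    ((tendsto_exp_rpow_div_atTop hl).eventually_ge_atTop (b / a))
  refine ⟨b * |S| + 1, by positivity, fun s hs => ?_⟩
  have hexp : 0 < a * Real.exp (s ^ l) := by positivity
  rcases le_total s |S| with h | h
  · linarith [mul_le_mul_of_nonneg_left h hb]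
  · rcases hs.eq_or_lt with rfl | hs'
    · have : 0 ≤ b * |S| := by positivity
      linarith
    · have h' := hS s ((le_abs_self S).trans h)
      rw [div_le_div_iff₀ ha hs'] at h'
      have : 0 ≤ b * |S| := by positivity
      linarith

lemma tendsto_expPotential_div_norm_sq {E : Type*} [NormedAddCommGroup E] [ProperSpace E]
    {c₁ l : ℝ} (c₂ : ℝ) (hc₁ : 0 < c₁) (hl : 0 < l) :
    Tendsto (fun x : E => (c₁ * Real.exp ((1 + ‖x‖ ^ 2) ^ l) - c₂ * ‖x‖ ^ 2) / ‖x‖ ^ 2)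
      (cocompact E) atTop := by
  have hnorm : Tendsto (fun x : E => 1 + ‖x‖ ^ 2) (cocompact E) atTop :=
    tendsto_atTop_add_const_left _ _
      ((tendsto_pow_atTop two_ne_zero).comp (tendsto_norm_cocompact_atTop (E := E)))
  refine tendsto_atTop_mono' _ ?_ (tendsto_atTop_add_const_right _ (-c₂)
    (((tendsto_exp_rpow_div_atTop hl).comp hnorm).const_mul_atTop hc₁))
  filter_upwards [(tendsto_norm_cocompact_atTop (E := E)).eventually_gt_atTop 0] with x hx
  have hx2 : 0 < ‖x‖ ^ 2 := by positivity
  rw [sub_div, mul_div_cancel_right₀ _ hx2.ne', mul_div_assoc, ← sub_eq_add_neg]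
  simp only [Function.comp]
  gcongr
  linarith

section Potential

variable {E : Type*} [NormedAddCommGroup E] [InnerProductSpace ℝ E]

lemma contDiff_expPotential (c₁ c₂ l : ℝ) {n : WithTop ℕ∞} :
    ContDiff ℝ n fun x : E => c₁ * Real.exp ((1 + ‖x‖ ^ 2) ^ l) - c₂ * ‖x‖ ^ 2 := by
  have hsq : ContDiff ℝ n fun x : E => ‖x‖ ^ 2 := contDiff_norm_sq ℝ
  have hbase : ContDiff ℝ n fun x : E => (1 + ‖x‖ ^ 2) ^ l :=
    (contDiff_const.add hsq).rpow_const_of_ne fun x => by positivity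
  exact (contDiff_const.mul hbase.exp).sub (contDiff_const.mul hsq)

lemma inner_gradient_expPotential [CompleteSpace E] (c₁ c₂ l : ℝ) (x : E) :
    ⟪x, gradient (fun x : E => c₁ * Real.exp ((1 + ‖x‖ ^ 2) ^ l) - c₂ * ‖x‖ ^ 2) x⟫ =
      2 * c₁ * l * (1 + ‖x‖ ^ 2) ^ (l - 1) * Real.exp ((1 + ‖x‖ ^ 2) ^ l) * ‖x‖ ^ 2
        - 2 * c₂ * ‖x‖ ^ 2 := by
  have hprofile : HasDerivAt (fun u : ℝ => c₁ * Real.exp ((1 + u) ^ l) - c₂ * u)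
      (c₁ * (Real.exp ((1 + ‖x‖ ^ 2) ^ l) * (1 * l * (1 + ‖x‖ ^ 2) ^ (l - 1))) - c₂ * 1)
      (‖x‖ ^ 2) :=
    (((((hasDerivAt_id (‖x‖ ^ 2)).const_add 1).rpow_const
      (Or.inl (by simp only [id]; positivity))).exp).const_mul c₁).sub
      ((hasDerivAt_id (‖x‖ ^ 2)).const_mul c₂)
  have hfd := hprofile.comp_hasFDerivAt x (hasStrictFDerivAt_norm_sq x).hasFDerivAt
  rw [real_inner_comm, inner_gradient_left]
  erw [hfd.fderiv]
  simp
  ring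

lemma exists_expPotential_le_inner_gradient [CompleteSpace E] {c₁ c₂ l : ℝ} (hc₁ : 0 < c₁)
    (hc₂ : 0 < c₂) (hl : 0 < l) :
    ∃ c₃ c₄ : ℝ, 0 < c₃ ∧ 0 < c₄ ∧ ∀ x : E,
      c₃ * (c₁ * Real.exp ((1 + ‖x‖ ^ 2) ^ l) - c₂ * ‖x‖ ^ 2) - c₄ ≤
        ⟪x, gradient (fun x : E => c₁ * Real.exp ((1 + ‖x‖ ^ 2) ^ l) - c₂ * ‖x‖ ^ 2) x⟫ := by
  obtain ⟨K, hK, hbound⟩ := exists_mul_le_mul_exp_rpow_add (a := l / 2 * c₁) (b := 2 * c₂)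
    (by positivity) (by positivity) hl
  refine ⟨l / 2, K + l / 2 * c₁ * Real.exp (2 ^ l) + 2 * c₂, by positivity, by positivity,
    fun x => ?_⟩
  rw [inner_gradient_expPotential]
  have hr : 0 ≤ ‖x‖ ^ 2 := by positivity
  generalize ‖x‖ ^ 2 = r at hr ⊢
  have hs : 1 ≤ 1 + r := by linarith
  have hquad : 0 ≤ l / 2 * (c₂ * r) := by positivity
  have hconst : 0 ≤ l / 2 * c₁ * Real.exp (2 ^ l) := by positivity
  rcases le_total r 1 with h | h
  · have hexp : l / 2 * c₁ * Real.exp ((1 + r) ^ l) ≤ l / 2 * c₁ * Real.exp (2 ^ l) := by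
      gcongr
      linarith
    have hmain : 0 ≤ 2 * c₁ * l * (1 + r) ^ (l - 1) * Real.exp ((1 + r) ^ l) * r := by
      positivity
    nlinarith
  · have hpow : (1 + r) ^ (l - 1) * (1 + r) = (1 + r) ^ l := by
      rw [← Real.rpow_add_one (by positivity), sub_add_cancel]
    have hone : 1 ≤ (1 + r) ^ l := Real.one_le_rpow hs hl.le
    have hhalf : 1 ≤ 2 * ((1 + r) ^ (l - 1) * r) := by
      have : 0 ≤ (1 + r) ^ (l - 1) * (r - 1) := mul_nonneg (by positivity) (by linarith)
      linarith
    have hmain : c₁ * l * Real.exp ((1 + r) ^ l) * 1 ≤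
        c₁ * l * Real.exp ((1 + r) ^ l) * (2 * ((1 + r) ^ (l - 1) * r)) := by
      gcongr
    linarith [hbound (1 + r) (by linarith)]

end Potential

/-- the exponential double-well potential `U₀(x) = c₁ e^{(1+|x|²)^l} − c₂|x|²`
with `l > 0` is `C¹`, has super-quadratic growth (`U₀(x)/|x|² → ∞` as `|x| → ∞`), and
satisfies `⟨x, ∇U₀(x)⟩ ≥ c₃ U₀(x) − c₄` for some constants `c₃, c₄ > 0`. -/
theorem stmt18 (d : ℕ) (c₁ c₂ l : ℝ) (hc₁ : 0 < c₁) (hc₂ : 0 < c₂) (hl : 0 < l)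
    (U₀ : EuclideanSpace ℝ (Fin d) → ℝ)
    (hU₀def : ∀ x, U₀ x = c₁ * Real.exp ((1 + ‖x‖ ^ 2) ^ l) - c₂ * ‖x‖ ^ 2) :
    ContDiff ℝ 1 U₀ ∧
      Tendsto (fun x : EuclideanSpace ℝ (Fin d) => U₀ x / ‖x‖ ^ 2) (cocompact _) atTop ∧
      ∃ c₃ c₄ : ℝ, 0 < c₃ ∧ 0 < c₄ ∧
        ∀ x : EuclideanSpace ℝ (Fin d), c₃ * U₀ x - c₄ ≤ ⟪x, gradient U₀ x⟫ := by
  obtain rfl := funext hU₀def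
  exact ⟨contDiff_expPotential c₁ c₂ l, tendsto_expPotential_div_norm_sq c₂ hc₁ hl,
    exists_expPotential_le_inner_gradient hc₁ hc₂ hl⟩
end
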